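/- Let 0 < p = q < ∞ and 0 < v < u ≤ ∞. Then there exist constants c, C > 0 depending only on p, u, v such that for all n ∈ ℕ: (i) for 1 ≤ k ≤ n, c · (log(n/k + 1))^{1/v − 1/u} ≤ e_k(id: ℓ_{p,u}^n → ℓ_{p,v}^n) ≤ C · (log(n/k + 1))^{1/v − 1/u}; (ii) for k ≥ n, c · 2^{−k/n} ≤ e_k(id: ℓ_{p,u}^n → ℓ_{p,v}^n) ≤ C · 2^{−k/n}. -/

import Mathlib

open scoped ENNReal Classical
open MeasureTheory

/-- The non-increasing rearrangement of `x : ℝ^n`: for `1 ≤ i ≤ n`,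
`rearr n x i` is the `i`-th largest of the absolute values of the entries of `x`,
defined via `x_i^* = inf {t ≥ 0 : #{j : |x j| > t} ≤ i - 1}`. -/
noncomputable def rearr (n : ℕ) (x : Fin n → ℝ) (i : ℕ) : ℝ :=
  sInf {t : ℝ | 0 ≤ t ∧ ((Finset.univ : Finset (Fin n)).filter (fun j => t < |x j|)).card ≤ i - 1}

/-- The Lorentz quasi-norm `‖x‖_{p,u}` on `ℝ^n` for `p, u ∈ (0,∞]`, with the
convention `1/∞ = 0`:  `‖x‖_{p,u} = (∑_{i=1}^n i^{u/p-1} (x_i^*)^u)^{1/u}` for `u < ∞`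
and `‖x‖_{p,∞} = max_{1 ≤ i ≤ n} i^{1/p} x_i^*`. -/
noncomputable def lorentzNorm (n : ℕ) (p u : ℝ≥0∞) (x : Fin n → ℝ) : ℝ :=
  if u = ⊤ then
    sSup {t : ℝ | ∃ i ∈ Finset.Icc 1 n, t = (i : ℝ) ^ (1 / p).toReal * rearr n x i}
  else
    (∑ i ∈ Finset.Icc 1 n, (i : ℝ) ^ ((u / p).toReal - 1) * rearr n x i ^ u.toReal) ^ (1 / u.toReal)

/-- The `k`-th (dyadic) entropy number of the identity map from `(ℝ^n, NX)` to `(ℝ^n, NY)`: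
`e_k = inf {ε > 0 : ∃ y_1, …, y_{2^{k-1}} with B_X ⊆ ⋃ (y_i + ε B_Y)}`. -/
noncomputable def entropyNumber (n : ℕ) (NX NY : (Fin n → ℝ) → ℝ) (k : ℕ) : ℝ :=
  sInf {ε : ℝ | 0 < ε ∧ ∃ T : Finset (Fin n → ℝ), T.card ≤ 2 ^ (k - 1) ∧
    ∀ x : Fin n → ℝ, NX x ≤ 1 → ∃ y ∈ T, NY (x - y) ≤ ε}

/-- The operator norm of the identity map from `(ℝ^n, NX)` to `(ℝ^n, NY)`:
`‖id‖ = sup {NY x : NX x ≤ 1}`. -/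
noncomputable def opNorm (n : ℕ) (NX NY : (Fin n → ℝ) → ℝ) : ℝ :=
  sSup {t : ℝ | ∃ x : Fin n → ℝ, NX x ≤ 1 ∧ t = NY x}

section Rearrangement

variable {n : ℕ} {x y : Fin n → ℝ} {i : ℕ} {t : ℝ}

lemma rearr_nonneg (n : ℕ) (x : Fin n → ℝ) (i : ℕ) : 0 ≤ rearr n x i :=
  Real.sInf_nonneg fun _ ht => ht.1

lemma rearr_le (ht : 0 ≤ t)
    (h : ((Finset.univ : Finset (Fin n)).filter (fun j => t < |x j|)).card ≤ i - 1) :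
    rearr n x i ≤ t :=
  csInf_le ⟨0, fun _ hs => hs.1⟩ ⟨ht, h⟩

lemma le_rearr (hi : 1 ≤ i)
    (h : i ≤ ((Finset.univ : Finset (Fin n)).filter (fun j => t ≤ |x j|)).card) :
    t ≤ rearr n x i := by
  refine le_csInf ⟨∑ j, |x j|, Finset.sum_nonneg fun _ _ => abs_nonneg _, ?_⟩ ?_
  · rw [Finset.card_eq_zero.2]
    · exact Nat.zero_le _
    · refine Finset.filter_eq_empty_iff.2 fun j _ => not_lt.2 ?_
      exact Finset.single_le_sum (f := fun j => |x j|) (fun _ _ => abs_nonneg _)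
        (Finset.mem_univ j)
  · rintro s ⟨_, hs⟩
    by_contra hst
    have : ((Finset.univ : Finset (Fin n)).filter (fun j => t ≤ |x j|)).card ≤
        ((Finset.univ : Finset (Fin n)).filter (fun j => s < |x j|)).card :=
      Finset.card_le_card fun j => by
        simp only [Finset.mem_filter, Finset.mem_univ, true_and]
        intro h
        linarith
    omega

/-- The infimum defining the rearrangement is attained. -/
lemma card_rearr_lt (n : ℕ) (x : Fin n → ℝ) (i : ℕ) (hi : 1 ≤ i) :
    ((Finset.univ : Finset (Fin n)).filter (fun j => rearr n x i < |x j|)).card ≤ i - 1 := by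
  by_contra h
  set A := (Finset.univ : Finset (Fin n)).filter (fun j => rearr n x i < |x j|) with hA
  have hne : A.Nonempty := by
    rw [← Finset.card_pos]
    omega
  obtain ⟨j, hj, hmin⟩ := A.exists_min_image (fun j => |x j|) hne
  have : |x j| ≤ rearr n x i := by
    refine le_rearr hi (le_trans (by omega : i ≤ A.card) (Finset.card_le_card fun l hl => ?_))
    simpa using hmin l hl
  have h2 := (Finset.mem_filter.1 hj).2
  linarith

lemma rearr_mono (hi : 1 ≤ i) (h : ∀ j, |x j| ≤ |y j|) : rearr n x i ≤ rearr n y i := by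
  refine rearr_le (rearr_nonneg _ _ _) (le_trans (Finset.card_le_card fun j => ?_)
    (card_rearr_lt n y i hi))
  simp only [Finset.mem_filter, Finset.mem_univ, true_and]
  exact fun hj => hj.trans_le (h j)

lemma rearr_le_of_forall (ht : 0 ≤ t) (h : ∀ j, |x j| ≤ t) : rearr n x i ≤ t := by
  refine rearr_le ht ?_
  rw [Finset.card_eq_zero.2 (Finset.filter_eq_empty_iff.2 fun j _ => not_lt.2 (h j))]
  exact Nat.zero_le _

lemma rearr_antitone {j : ℕ} (hi : 1 ≤ i) (hij : i ≤ j) : rearr n x j ≤ rearr n x i :=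
  rearr_le (rearr_nonneg _ _ _) ((card_rearr_lt n x i hi).trans (by omega))

lemma rearr_sub_le {j : ℕ} (hj : 1 ≤ j) (hij : 2 * j ≤ i + 1) :
    rearr n (x - y) i ≤ rearr n x j + rearr n y j := by
  refine rearr_le (add_nonneg (rearr_nonneg _ _ _) (rearr_nonneg _ _ _)) ?_
  have h1 := card_rearr_lt n x j hj
  have h2 := card_rearr_lt n y j hj
  have h3 : ((Finset.univ : Finset (Fin n)).filter
      (fun l => rearr n x j + rearr n y j < |(x - y) l|)) ⊆
      ((Finset.univ : Finset (Fin n)).filter (fun l => rearr n x j < |x l|)) ∪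
      ((Finset.univ : Finset (Fin n)).filter (fun l => rearr n y j < |y l|)) := by
    intro l
    simp only [Finset.mem_filter, Finset.mem_univ, true_and, Finset.mem_union, Pi.sub_apply]
    intro h
    by_contra hc
    push Not at hc
    have := abs_sub (x l) (y l)
    linarith [hc.1, hc.2]
  have := (Finset.card_le_card h3).trans (Finset.card_union_le _ _)
  omega

end Rearrangement

section SumEstimates

lemma sum_rpow_le {a : ℝ} (ha : 0 < a) (n : ℕ) :
    ∑ i ∈ Finset.Icc 1 n, (i : ℝ) ^ (a - 1) ≤ max 1 a⁻¹ * (n : ℝ) ^ a := by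
  rcases le_total 1 a with h | h
  · calc ∑ i ∈ Finset.Icc 1 n, (i : ℝ) ^ (a - 1)
        ≤ ∑ i ∈ Finset.Icc 1 n, (n : ℝ) ^ (a - 1) := by
          refine Finset.sum_le_sum fun i hi => ?_
          have := (Finset.mem_Icc.1 hi).2
          exact Real.rpow_le_rpow (by positivity) (by exact_mod_cast this) (by linarith)
      _ = (n : ℝ) ^ a := by
          rcases Nat.eq_zero_or_pos n with rfl | hn
          · simp [Real.zero_rpow ha.ne']
          · have : (0 : ℝ) < n := by exact_mod_cast hn
            rw [Finset.sum_const, Nat.card_Icc, nsmul_eq_mul, Real.rpow_sub_one this.ne']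
            simp only [add_tsub_cancel_right]
            field_simp
      _ ≤ max 1 a⁻¹ * (n : ℝ) ^ a := le_mul_of_one_le_left (by positivity) (le_max_left _ _)
  · refine le_trans ?_ (mul_le_mul_of_nonneg_right (le_max_right _ _) (by positivity))
    induction n with
    | zero => simp [Real.zero_rpow ha.ne']
    | succ n ih =>
      rw [Finset.sum_Icc_succ_top (by omega)]
      have hn : (0 : ℝ) < (n : ℝ) + 1 := by positivity
      have hb := rpow_one_add_le_one_add_mul_self (s := -(1 / ((n : ℝ) + 1)))
        (by rw [neg_le_neg_iff, div_le_one hn]; linarith [(Nat.cast_nonneg n : (0:ℝ) ≤ n)])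
        ha.le h
      have e1 : 1 + -(1 / ((n : ℝ) + 1)) = n / (n + 1) := by field_simp; ring
      rw [e1, Real.div_rpow (by positivity) hn.le, div_le_iff₀ (by positivity)] at hb
      have e2 : ((n : ℝ) + 1) ^ a = ((n : ℝ) + 1) ^ (a - 1) * (n + 1) := by
        rw [Real.rpow_sub_one hn.ne']; field_simp
      have e3 : (1 + a * -(1 / ((n : ℝ) + 1))) * ((n : ℝ) + 1) ^ a =
          ((n : ℝ) + 1) ^ a - a * ((n : ℝ) + 1) ^ (a - 1) := by
        rw [e2]; field_simp; ring
      push_cast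
      rw [e3] at hb
      have : ((n : ℝ) + 1) ^ (a - 1) ≤ a⁻¹ * (((n : ℝ) + 1) ^ a - (n : ℝ) ^ a) := by
        rw [inv_mul_eq_div, le_div_iff₀ ha]; linarith
      linarith

lemma le_sum_rpow {a : ℝ} (ha : 0 < a) (n : ℕ) :
    (max 1 a)⁻¹ * (n : ℝ) ^ a ≤ ∑ i ∈ Finset.Icc 1 n, (i : ℝ) ^ (a - 1) := by
  rw [inv_mul_le_iff₀ (by positivity)]
  have hs : 0 ≤ ∑ i ∈ Finset.Icc 1 n, (i : ℝ) ^ (a - 1) :=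
    Finset.sum_nonneg fun _ _ => by positivity
  rcases le_total a 1 with h | h
  · refine le_trans ?_ (le_mul_of_one_le_left hs (le_max_left _ _))
    calc (n : ℝ) ^ a = ∑ i ∈ Finset.Icc 1 n, (n : ℝ) ^ (a - 1) := by
          rcases Nat.eq_zero_or_pos n with rfl | hn
          · simp [Real.zero_rpow ha.ne']
          · have : (0 : ℝ) < n := by exact_mod_cast hn
            rw [Finset.sum_const, Nat.card_Icc, nsmul_eq_mul, Real.rpow_sub_one this.ne']
            simp only [add_tsub_cancel_right]
            field_simp
      _ ≤ _ := by
          refine Finset.sum_le_sum fun i hi => ?_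
          have := Finset.mem_Icc.1 hi
          exact Real.rpow_le_rpow_of_nonpos (by exact_mod_cast this.1) (by exact_mod_cast this.2)
            (by linarith)
  · refine le_trans ?_ (mul_le_mul_of_nonneg_right (le_max_right _ _) hs)
    clear hs
    induction n with
    | zero => simp [Real.zero_rpow ha.ne']
    | succ n ih =>
      rw [Finset.sum_Icc_succ_top (by omega)]
      have hn : (0 : ℝ) < (n : ℝ) + 1 := by positivity
      have hb := one_add_mul_self_le_rpow_one_add (s := -(1 / ((n : ℝ) + 1)))
        (by rw [neg_le_neg_iff, div_le_one hn]; linarith [(Nat.cast_nonneg n : (0:ℝ) ≤ n)]) h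
      have e1 : 1 + -(1 / ((n : ℝ) + 1)) = n / (n + 1) := by field_simp; ring
      rw [e1, Real.div_rpow (by positivity) hn.le, le_div_iff₀ (by positivity)] at hb
      have e2 : ((n : ℝ) + 1) ^ a = ((n : ℝ) + 1) ^ (a - 1) * (n + 1) := by
        rw [Real.rpow_sub_one hn.ne']; field_simp
      have e3 : (1 + a * -(1 / ((n : ℝ) + 1))) * ((n : ℝ) + 1) ^ a =
          ((n : ℝ) + 1) ^ a - a * ((n : ℝ) + 1) ^ (a - 1) := by
        rw [e2]; field_simp; ring
      push_cast
      rw [e3] at hb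
      rw [mul_add]
      linarith

lemma sum_Ioc_inv_le_log {a b : ℕ} (ha : 1 ≤ a) (hab : a ≤ b) :
    ∑ i ∈ Finset.Ioc a b, (i : ℝ)⁻¹ ≤ Real.log b - Real.log a := by
  induction b, hab using Nat.le_induction with
  | base => simp
  | succ b hb ih =>
    rw [Finset.sum_Ioc_succ_top hb]
    have hb0 : (0 : ℝ) < b := by exact_mod_cast (by omega : 0 < b)
    have := Real.one_sub_inv_le_log_of_pos (x := ((b : ℝ) + 1) / b) (by positivity)
    rw [Real.log_div (by positivity) hb0.ne'] at this
    have e : 1 - (((b : ℝ) + 1) / b)⁻¹ = ((b : ℝ) + 1)⁻¹ := by field_simp; ring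
    push_cast
    linarith

lemma log_le_sum_Ioc_inv {a b : ℕ} (hab : a ≤ b) :
    Real.log (b + 1) - Real.log (a + 1) ≤ ∑ i ∈ Finset.Ioc a b, (i : ℝ)⁻¹ := by
  induction b, hab using Nat.le_induction with
  | base => simp
  | succ b hb ih =>
    rw [Finset.sum_Ioc_succ_top hb]
    have hb0 : (0 : ℝ) < (b : ℝ) + 1 := by positivity
    have := Real.log_le_sub_one_of_pos (x := ((b : ℝ) + 1 + 1) / (b + 1)) (by positivity)
    rw [Real.log_div (by positivity) hb0.ne'] at this
    have e : ((b : ℝ) + 1 + 1) / (b + 1) - 1 = ((b : ℝ) + 1)⁻¹ := by field_simp; ring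
    push_cast
    linarith

lemma sum_inv_filter_le {n : ℕ} (hn : 1 ≤ n) {N : ℝ} (hN : 0 < N) (hNn : N ≤ n) :
    ∑ i ∈ (Finset.Icc 1 n).filter (fun i : ℕ => N < i), (i : ℝ)⁻¹ ≤
      1 + Real.log (n / N) := by
  have hn0 : (0 : ℝ) < n := by exact_mod_cast hn
  rw [Real.log_div hn0.ne' hN.ne']
  rcases lt_or_ge N 1 with h | h
  · have h1 := sum_Ioc_inv_le_log le_rfl hn
    have h2 : ∑ i ∈ Finset.Icc 1 n, (i : ℝ)⁻¹ = 1 + ∑ i ∈ Finset.Ioc 1 n, (i : ℝ)⁻¹ := by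
      rw [← Finset.add_sum_Ioc_eq_sum_Icc hn]
      simp
    have h3 : Real.log N ≤ 0 := Real.log_nonpos hN.le h.le
    have h4 : ∑ i ∈ (Finset.Icc 1 n).filter (fun i : ℕ => N < i), (i : ℝ)⁻¹ ≤
        ∑ i ∈ Finset.Icc 1 n, (i : ℝ)⁻¹ :=
      Finset.sum_le_sum_of_subset_of_nonneg (Finset.filter_subset _ _)
        fun _ _ _ => by positivity
    simp only [Nat.cast_one, Real.log_one] at h1
    linarith
  · have hf : 1 ≤ ⌊N⌋₊ := Nat.le_floor (by simpa using h)
    have hfn : ⌊N⌋₊ ≤ n := by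
      have := Nat.floor_le hN.le
      exact_mod_cast this.trans hNn
    have h1 := sum_Ioc_inv_le_log hf hfn
    have h4 : ∑ i ∈ (Finset.Icc 1 n).filter (fun i : ℕ => N < i), (i : ℝ)⁻¹ ≤
        ∑ i ∈ Finset.Ioc ⌊N⌋₊ n, (i : ℝ)⁻¹ := by
      refine Finset.sum_le_sum_of_subset_of_nonneg (fun i hi => ?_) fun _ _ _ => by positivity
      simp only [Finset.mem_filter, Finset.mem_Icc] at hi
      exact Finset.mem_Ioc.2 ⟨(Nat.floor_lt hN.le).2 hi.2, hi.1.2⟩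
    have h5 : Real.log N ≤ Real.log ⌊N⌋₊ + 1 := by
      have hf0 : (1 : ℝ) ≤ (⌊N⌋₊ : ℝ) := by exact_mod_cast hf
      have h6 : N ≤ 2 * (⌊N⌋₊ : ℝ) := by linarith [Nat.lt_floor_add_one N]
      have h7 := Real.log_le_log hN h6
      rw [Real.log_mul (by norm_num) (by positivity)] at h7
      linarith [Real.log_two_lt_d9]
    linarith

/-- A profile that is flat up to index `N` and decays like `i ^ (-1/p)` afterwards. -/
lemma sum_rpow_mul_le {n : ℕ} {a N A D : ℝ} {f : ℕ → ℝ} (ha : 0 < a) (hN : 0 < N)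
    (hA : 0 ≤ A) (h1 : ∀ i ∈ Finset.Icc 1 n, f i ≤ A * N ^ (-a))
    (h2 : ∑ i ∈ (Finset.Icc 1 n).filter (fun i : ℕ => N < i), (i : ℝ) ^ (a - 1) * f i ≤ D) :
    ∑ i ∈ Finset.Icc 1 n, (i : ℝ) ^ (a - 1) * f i ≤ A * max 1 a⁻¹ + D := by
  rw [← Finset.sum_filter_add_sum_filter_not _ (fun i : ℕ => N < i), add_comm]
  refine add_le_add ?_ h2
  calc _ ≤ ∑ i ∈ (Finset.Icc 1 n).filter (fun i : ℕ => ¬ N < i),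
          (i : ℝ) ^ (a - 1) * (A * N ^ (-a)) :=
        Finset.sum_le_sum fun i hi =>
          mul_le_mul_of_nonneg_left (h1 i (Finset.mem_filter.1 hi).1) (by positivity)
    _ ≤ ∑ i ∈ Finset.Icc 1 ⌊N⌋₊, (i : ℝ) ^ (a - 1) * (A * N ^ (-a)) := by
        refine Finset.sum_le_sum_of_subset_of_nonneg (fun i hi => ?_) fun _ _ _ => by positivity
        simp only [Finset.mem_filter, Finset.mem_Icc, not_lt] at hi
        exact Finset.mem_Icc.2 ⟨hi.1.1, Nat.le_floor hi.2⟩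
    _ = (∑ i ∈ Finset.Icc 1 ⌊N⌋₊, (i : ℝ) ^ (a - 1)) * (A * N ^ (-a)) := by
        rw [Finset.sum_mul]
    _ ≤ (max 1 a⁻¹ * N ^ a) * (A * N ^ (-a)) := by
        refine mul_le_mul_of_nonneg_right ((sum_rpow_le ha _).trans ?_) (by positivity)
        gcongr
        exact Nat.floor_le hN.le
    _ = A * max 1 a⁻¹ := by
        rw [Real.rpow_neg hN.le]
        have := (Real.rpow_pos_of_pos hN a).ne'
        field_simp

end SumEstimates

section Counting

/-- If the `j`-th coordinate in modulus of `f` is dominated in the weak sense, the product of the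
coordinates is at most `N ^ a / a!`. -/
lemma prod_le_pow_div_factorial {ι : Type*} {N : ℝ} (hN : 0 ≤ N) (f : ι → ℝ)
    (A : Finset ι) (hf : ∀ i ∈ A, 0 ≤ f i)
    (h : ∀ j ∈ A, ((A.filter (fun i => f j ≤ f i)).card : ℝ) * f j ≤ N) :
    ∏ i ∈ A, f i ≤ N ^ A.card / (A.card.factorial : ℝ) := by
  induction A using Finset.strongInduction with
  | H A ih =>
    rcases A.eq_empty_or_nonempty with rfl | hne
    · simp
    obtain ⟨j, hj, hmin⟩ := A.exists_min_image f hne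
    have h1 := ih (A.erase j) (Finset.erase_ssubset hj)
      (fun i hi => hf i (Finset.mem_of_mem_erase hi)) (fun i hi => by
        refine le_trans (mul_le_mul_of_nonneg_right ?_ (hf i (Finset.mem_of_mem_erase hi)))
          (h i (Finset.mem_of_mem_erase hi))
        exact_mod_cast Finset.card_le_card
          (Finset.filter_subset_filter _ (Finset.erase_subset j A)))
    have h2 := h j hj
    rw [Finset.filter_true_of_mem hmin] at h2
    obtain ⟨a, ha⟩ : ∃ a, A.card = a + 1 :=
      ⟨A.card - 1, by have := Finset.card_pos.2 hne; omega⟩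
    rw [Finset.card_erase_of_mem hj, ha, Nat.add_sub_cancel] at h1
    rw [← Finset.mul_prod_erase A f hj, ha, Nat.factorial_succ]
    rw [ha] at h2
    push_cast at h2 ⊢
    have h3 : f j ≤ N / (a + 1) := by
      rw [le_div_iff₀ (by positivity)]; linarith
    calc f j * ∏ i ∈ A.erase j, f i
        ≤ (N / (a + 1)) * (N ^ a / (a.factorial : ℝ)) :=
          mul_le_mul h3 h1 (Finset.prod_nonneg fun i hi => hf i (Finset.mem_of_mem_erase hi))
            (by positivity)
      _ = _ := by
          field_simp
          ring

/-- The weight used to count lattice points of weak `ℓ_p` balls. -/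
noncomputable def latticeWeight (δ : ℝ) (t : ℤ) : ℝ := if t = 0 then 1 else δ / (t : ℝ) ^ 2

lemma latticeWeight_nonneg {δ : ℝ} (hδ : 0 ≤ δ) (t : ℤ) : 0 ≤ latticeWeight δ t := by
  unfold latticeWeight
  split_ifs <;> positivity

lemma sum_latticeWeight_le {δ : ℝ} (hδ : 0 ≤ δ) (R : ℕ) :
    ∑ t ∈ Finset.Icc (-(R : ℤ)) R, latticeWeight δ t ≤ 1 + 4 * δ := by
  suffices h : ∑ t ∈ Finset.Icc (-(R : ℤ)) R, latticeWeight δ t ≤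
      1 + 4 * δ - 4 * δ / (R + 1) by
    have : 0 ≤ 4 * δ / ((R : ℝ) + 1) := by positivity
    linarith
  induction R with
  | zero => simp [latticeWeight]
  | succ R ih =>
    have e : Finset.Icc (-((R + 1 : ℕ) : ℤ)) ((R + 1 : ℕ) : ℤ) =
        insert (-((R : ℤ) + 1)) (insert ((R : ℤ) + 1) (Finset.Icc (-(R : ℤ)) R)) := by
      ext t
      simp only [Finset.mem_insert, Finset.mem_Icc]
      push_cast
      omega
    rw [e, Finset.sum_insert, Finset.sum_insert]
    · have hR : ((R : ℤ) + 1) ≠ 0 := by positivity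
      have hR' : (-((R : ℤ) + 1)) ≠ 0 := neg_ne_zero.2 hR
      simp only [latticeWeight, hR, hR', if_false] at ih ⊢
      push_cast
      have h2 : 2 * (δ / ((R : ℝ) + 1) ^ 2) ≤ 4 * δ / (R + 1) - 4 * δ / (R + 1 + 1) := by
        have hR0 : (0 : ℝ) ≤ R := Nat.cast_nonneg R
        have e4 : 4 * δ / ((R : ℝ) + 1) - 4 * δ / (R + 1 + 1) - 2 * (δ / ((R : ℝ) + 1) ^ 2) =
            2 * δ * R / (((R : ℝ) + 1) ^ 2 * (R + 2)) := by
          field_simp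
          ring
        have : 0 ≤ 2 * δ * R / (((R : ℝ) + 1) ^ 2 * (R + 2)) := by positivity
        linarith
      rw [neg_add_rev, ← sub_eq_add_neg] at *
      have e5 : ((-1 : ℝ) - R) ^ 2 = (R + 1) ^ 2 := by ring
      rw [e5]
      linarith
    · simp only [Finset.mem_Icc]; omega
    · simp only [Finset.mem_insert, Finset.mem_Icc]; omega

/-- `z` lies in the weak `ℓ_p` ball of radius `N ^ (1/p)`. -/
def WeakBound {n : ℕ} (p N : ℝ) (z : Fin n → ℤ) : Prop :=
  ∀ j, z j ≠ 0 →
    (((Finset.univ : Finset (Fin n)).filter (fun i => |z j| ≤ |z i|)).card : ℝ) *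
      (|z j| : ℝ) ^ p ≤ N

lemma WeakBound.rpow_le {n : ℕ} {p N : ℝ} {z : Fin n → ℤ} (h : WeakBound p N z) {j : Fin n}
    (hj : z j ≠ 0) : (|z j| : ℝ) ^ p ≤ N := by
  refine le_trans (le_mul_of_one_le_left (by positivity) ?_) (h j hj)
  have : 0 < ((Finset.univ : Finset (Fin n)).filter (fun i => |z j| ≤ |z i|)).card :=
    Finset.card_pos.2 ⟨j, by simp⟩
  exact_mod_cast this

lemma one_le_abs_cast {t : ℤ} (ht : t ≠ 0) : (1 : ℝ) ≤ |(t : ℝ)| := by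
  rw [← Int.cast_abs]
  exact_mod_cast Int.one_le_abs ht

lemma WeakBound.eq_zero {n : ℕ} {p N : ℝ} (hp : 0 < p) (hN : N < 1) {z : Fin n → ℤ}
    (h : WeakBound p N z) : z = 0 := by
  funext j
  by_contra hj
  have := h.rpow_le hj
  linarith [Real.one_le_rpow (one_le_abs_cast hj) hp.le]

lemma le_prod_latticeWeight {n : ℕ} {p N δ : ℝ} (hp : 0 < p) (hN : 0 ≤ N) (hδ : 0 < δ)
    (hδ1 : δ ≤ 1) {z : Fin n → ℤ} (h : WeakBound p N z) :
    δ ^ N * Real.exp (-(2 * N / p)) ≤ ∏ j, latticeWeight δ (z j) := by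
  set A := (Finset.univ : Finset (Fin n)).filter (fun j => z j ≠ 0) with hA
  have hz : ∀ j ∈ A, z j ≠ 0 := fun j hj => (Finset.mem_filter.1 hj).2
  have hprod : ∏ j, latticeWeight δ (z j) = δ ^ A.card / (∏ j ∈ A, |(z j : ℝ)|) ^ 2 := by
    rw [← Finset.prod_filter_mul_prod_filter_not Finset.univ (fun j => z j ≠ 0)]
    have h1 : ∏ j ∈ A, latticeWeight δ (z j) = ∏ j ∈ A, δ / |(z j : ℝ)| ^ 2 :=
      Finset.prod_congr rfl fun j hj => by simp [latticeWeight, hz j hj]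
    have h2 : ∏ j ∈ Finset.univ.filter (fun j => ¬ z j ≠ 0), latticeWeight δ (z j) = 1 :=
      Finset.prod_eq_one fun j hj => by
        simp only [Finset.mem_filter, not_not] at hj
        simp [latticeWeight, hj.2]
    rw [h1, h2, mul_one, Finset.prod_div_distrib, Finset.prod_const, Finset.prod_pow]
  have hle : ∀ j ∈ A, ((A.filter (fun i => |(z j : ℝ)| ^ p ≤ |(z i : ℝ)| ^ p)).card : ℝ) *
      |(z j : ℝ)| ^ p ≤ N := by
    intro j hj
    refine le_trans (mul_le_mul_of_nonneg_right ?_ (by positivity)) (h j (hz j hj))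
    refine Nat.cast_le.2 (Finset.card_le_card fun i hi => ?_)
    have := (Finset.mem_filter.1 hi).2
    rw [Real.rpow_le_rpow_iff (abs_nonneg _) (abs_nonneg _) hp] at this
    simp only [Finset.mem_filter, Finset.mem_univ, true_and]
    exact_mod_cast this
  have hcard : (A.card : ℝ) ≤ N := by
    rcases A.eq_empty_or_nonempty with h0 | hne
    · simpa [h0] using hN
    obtain ⟨j, hj, hmin⟩ := A.exists_min_image (fun i => |(z i : ℝ)| ^ p) hne
    have h1 := hle j hj
    rw [Finset.filter_true_of_mem hmin] at h1
    refine le_trans (le_mul_of_one_le_right (by positivity) ?_) h1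
    exact Real.one_le_rpow (one_le_abs_cast (hz j hj)) hp.le
  have hP : (∏ j ∈ A, |(z j : ℝ)|) ^ p ≤ Real.exp N := by
    rw [← Real.finsetProd_rpow _ _ fun _ _ => abs_nonneg _]
    exact (prod_le_pow_div_factorial hN (fun j => |(z j : ℝ)| ^ p) A
      (fun _ _ => by positivity) hle).trans (Real.pow_div_factorial_le_exp N hN _)
  have hP0 : 0 < ∏ j ∈ A, |(z j : ℝ)| :=
    Finset.prod_pos fun j hj => by linarith [one_le_abs_cast (hz j hj)]
  have hP1 : ∏ j ∈ A, |(z j : ℝ)| ≤ Real.exp (N / p) := by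
    rw [← Real.rpow_le_rpow_iff hP0.le (Real.exp_pos _).le hp, ← Real.exp_mul,
      div_mul_cancel₀ _ hp.ne']
    exact hP
  rw [hprod, div_eq_mul_inv]
  refine mul_le_mul ?_ ?_ (Real.exp_pos _).le (by positivity)
  · rw [← Real.rpow_natCast]
    exact Real.rpow_le_rpow_of_exponent_ge hδ hδ1 hcard
  · rw [Real.exp_neg]
    refine inv_anti₀ (by positivity) ?_
    calc (∏ j ∈ A, |(z j : ℝ)|) ^ 2 ≤ Real.exp (N / p) ^ 2 := by gcongr
      _ = Real.exp (2 * N / p) := by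
        rw [← Real.exp_nat_mul]; congr 1; push_cast; ring

lemma card_le_of_weakBound {n : ℕ} {p N δ : ℝ} (hp : 0 < p) (hN : 0 ≤ N) (hδ : 0 < δ)
    (hδ1 : δ ≤ 1) (F : Finset (Fin n → ℤ)) (hF : ∀ z ∈ F, WeakBound p N z) :
    (F.card : ℝ) ≤ Real.exp (4 * δ * n) * δ ^ (-N) * Real.exp (2 * N / p) := by
  obtain ⟨R, hR⟩ : ∃ R : ℕ, ∀ z ∈ F, ∀ j, |z j| ≤ R := by
    refine ⟨∑ z ∈ F, ∑ j, (z j).natAbs, fun z hz j => ?_⟩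
    have h1 : (z j).natAbs ≤ ∑ j, (z j).natAbs :=
      Finset.single_le_sum (f := fun j => (z j).natAbs) (fun _ _ => Nat.zero_le _)
        (Finset.mem_univ j)
    have h2 : ∑ j, (z j).natAbs ≤ ∑ z ∈ F, ∑ j, (z j).natAbs :=
      Finset.single_le_sum (f := fun z : Fin n → ℤ => ∑ j, (z j).natAbs)
        (fun _ _ => Nat.zero_le _) hz
    rw [Int.abs_eq_natAbs]
    exact_mod_cast h1.trans h2
  have hsub : F ⊆ Fintype.piFinset fun _ : Fin n => Finset.Icc (-(R : ℤ)) R := fun z hz => by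
    rw [Fintype.mem_piFinset]
    exact fun j => Finset.mem_Icc.2 (abs_le.1 (hR z hz j))
  have h1 : (F.card : ℝ) * (δ ^ N * Real.exp (-(2 * N / p))) ≤ Real.exp (4 * δ * n) :=
    calc (F.card : ℝ) * (δ ^ N * Real.exp (-(2 * N / p)))
        = ∑ z ∈ F, δ ^ N * Real.exp (-(2 * N / p)) := by
          rw [Finset.sum_const, nsmul_eq_mul]
      _ ≤ ∑ z ∈ F, ∏ j, latticeWeight δ (z j) :=
          Finset.sum_le_sum fun z hz => le_prod_latticeWeight hp hN hδ hδ1 (hF z hz)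
      _ ≤ ∑ z ∈ Fintype.piFinset fun _ : Fin n => Finset.Icc (-(R : ℤ)) R,
            ∏ j, latticeWeight δ (z j) :=
          Finset.sum_le_sum_of_subset_of_nonneg hsub fun _ _ _ =>
            Finset.prod_nonneg fun _ _ => latticeWeight_nonneg hδ.le _
      _ = (∑ t ∈ Finset.Icc (-(R : ℤ)) R, latticeWeight δ t) ^ n := by
          rw [← Finset.prod_univ_sum]
          simp
      _ ≤ Real.exp (4 * δ) ^ n := by
          refine pow_le_pow_left₀ (Finset.sum_nonneg fun _ _ => latticeWeight_nonneg hδ.le _) ?_ n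
          refine (sum_latticeWeight_le hδ.le R).trans ?_
          linarith [Real.add_one_le_exp (4 * δ)]
      _ = Real.exp (4 * δ * n) := by
          rw [← Real.exp_nat_mul]; congr 1; ring
  rw [Real.rpow_neg hδ.le, mul_assoc]
  rw [Real.exp_neg, ← le_div_iff₀ (by positivity)] at h1
  refine h1.trans (le_of_eq ?_)
  have := (Real.exp_pos (2 * N / p)).ne'
  have := (Real.rpow_pos_of_pos hδ N).ne'
  field_simp

lemma exists_finset_weakBound {n : ℕ} {p N : ℝ} (hp : 0 < p) (hN : 0 ≤ N) :
    ∃ F : Finset (Fin n → ℤ), ∀ z, z ∈ F ↔ WeakBound p N z := by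
  refine ⟨((Fintype.piFinset fun _ : Fin n =>
    Finset.Icc (-(⌈N ^ (1 / p)⌉)) ⌈N ^ (1 / p)⌉)).filter (WeakBound p N), fun z => ?_⟩
  rw [Finset.mem_filter, Fintype.mem_piFinset, and_iff_right_iff_imp]
  intro h j
  rw [Finset.mem_Icc, ← abs_le]
  rcases eq_or_ne (z j) 0 with h0 | h0
  · rw [h0, abs_zero]
    exact Int.ceil_nonneg (Real.rpow_nonneg hN (1 / p))
  · have h1 := h.rpow_le h0
    have h2 : |(z j : ℝ)| ≤ N ^ (1 / p) := by
      rw [one_div, ← Real.rpow_rpow_inv (abs_nonneg (z j : ℝ)) hp.ne']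
      exact Real.rpow_le_rpow (by positivity) h1 (by positivity)
    have := h2.trans (Int.le_ceil _)
    exact_mod_cast this

end Counting

section Norms

/-- The `v`-th power of the Lorentz quasi-norm, with `a = v / p`. -/
noncomputable def lorentzSum (n : ℕ) (a v : ℝ) (x : Fin n → ℝ) : ℝ :=
  ∑ i ∈ Finset.Icc 1 n, (i : ℝ) ^ (a - 1) * rearr n x i ^ v

lemma lorentzSum_nonneg (n : ℕ) (a v : ℝ) (x : Fin n → ℝ) : 0 ≤ lorentzSum n a v x :=
  Finset.sum_nonneg fun _ _ =>
    mul_nonneg (by positivity) (Real.rpow_nonneg (rearr_nonneg _ _ _) _)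

lemma lorentzNorm_le_iff {n : ℕ} {p v : ℝ≥0∞} (hv : 0 < v) (hv' : v ≠ ⊤) {x : Fin n → ℝ} {ε : ℝ}
    (hε : 0 ≤ ε) :
    lorentzNorm n p v x ≤ ε ↔
      lorentzSum n (v.toReal / p.toReal) v.toReal x ≤ ε ^ v.toReal := by
  have h0 : 0 < v.toReal := ENNReal.toReal_pos hv.ne' hv'
  rw [lorentzNorm, if_neg hv', ENNReal.toReal_div, one_div]
  exact Real.rpow_inv_le_iff_of_pos (lorentzSum_nonneg n _ _ x) hε h0

lemma rpow_mul_le_of_rearr_le {a v A y : ℝ} {i : ℕ} {p : ℝ} (hi : 1 ≤ i) (hA : 0 ≤ A)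
    (hv : 0 < v) (ha : a = v / p) (hy0 : 0 ≤ y) (hy : y ≤ A * (i : ℝ) ^ (-p⁻¹)) :
    (i : ℝ) ^ (a - 1) * y ^ v ≤ A ^ v * (i : ℝ)⁻¹ := by
  have hi0 : (0 : ℝ) < i := by exact_mod_cast hi
  calc (i : ℝ) ^ (a - 1) * y ^ v ≤ (i : ℝ) ^ (a - 1) * (A * (i : ℝ) ^ (-p⁻¹)) ^ v := by gcongr
    _ = A ^ v * ((i : ℝ) ^ (a - 1) * (i : ℝ) ^ (-p⁻¹ * v)) := by
        rw [Real.mul_rpow hA (by positivity), ← Real.rpow_mul hi0.le]; ring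
    _ = A ^ v * (i : ℝ)⁻¹ := by
        rw [← Real.rpow_add hi0, show a - 1 + -p⁻¹ * v = -1 by rw [ha]; ring, Real.rpow_neg_one]

lemma sum_half_le {g : ℕ → ℝ} (hg : ∀ i, 0 ≤ g i) (n : ℕ) :
    ∑ i ∈ Finset.Icc 1 n, g ((i + 1) / 2) ≤ 2 * ∑ j ∈ Finset.Icc 1 n, g j := by
  have h : ∑ i ∈ Finset.Icc 1 (2 * n), g ((i + 1) / 2) = 2 * ∑ j ∈ Finset.Icc 1 n, g j := by
    induction n with
    | zero => simp
    | succ n ih =>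
      rw [show 2 * (n + 1) = 2 * n + 1 + 1 by ring, Finset.sum_Icc_succ_top (by omega),
        Finset.sum_Icc_succ_top (by omega), ih, Finset.sum_Icc_succ_top (by omega),
        show (2 * n + 1 + 1) / 2 = n + 1 by omega, show (2 * n + 1 + 1 + 1) / 2 = n + 1 by omega]
      ring
  rw [← h]
  exact Finset.sum_le_sum_of_subset_of_nonneg (Finset.Icc_subset_Icc_right (by omega))
    fun _ _ _ => hg _

lemma lorentzSum_sub_le {n : ℕ} {a v : ℝ} (ha : 0 < a) (hv : 0 < v) (x y : Fin n → ℝ) :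
    lorentzSum n a v (x - y) ≤
      2 * (2 ^ a * 2 ^ v) * (lorentzSum n a v x + lorentzSum n a v y) := by
  set g : ℕ → ℝ := fun j => 2 ^ a * 2 ^ v * ((j : ℝ) ^ (a - 1) * rearr n x j ^ v +
    (j : ℝ) ^ (a - 1) * rearr n y j ^ v) with hg
  have hr := rearr_nonneg n
  calc lorentzSum n a v (x - y) ≤ ∑ i ∈ Finset.Icc 1 n, g ((i + 1) / 2) := by
        refine Finset.sum_le_sum fun i hi => ?_
        have hi1 := (Finset.mem_Icc.1 hi).1
        obtain ⟨j, hj⟩ : ∃ j, j = (i + 1) / 2 := ⟨_, rfl⟩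
        rw [← hj]
        have hj1 : 1 ≤ j := by omega
        have hj0 : (0 : ℝ) < j := by exact_mod_cast hj1
        have hi0 : (0 : ℝ) < i := by exact_mod_cast hi1
        have e1 : (i : ℝ) ^ (a - 1) ≤ 2 ^ a * (j : ℝ) ^ (a - 1) := by
          rcases le_total 1 a with h | h
          · calc (i : ℝ) ^ (a - 1) ≤ (2 * (j : ℝ)) ^ (a - 1) := by
                  refine Real.rpow_le_rpow hi0.le ?_ (by linarith)
                  exact_mod_cast (by omega : i ≤ 2 * j)
              _ = 2 ^ (a - 1) * (j : ℝ) ^ (a - 1) := Real.mul_rpow (by norm_num) hj0.le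
              _ ≤ _ := by
                  gcongr
                  · norm_num
                  · linarith
          · calc (i : ℝ) ^ (a - 1) ≤ (j : ℝ) ^ (a - 1) :=
                  Real.rpow_le_rpow_of_nonpos hj0 (by exact_mod_cast (by omega : j ≤ i))
                    (by linarith)
              _ ≤ _ := le_mul_of_one_le_left (by positivity)
                  (Real.one_le_rpow (by norm_num) ha.le)
        have e2 : rearr n (x - y) i ^ v ≤ 2 ^ v * (rearr n x j ^ v + rearr n y j ^ v) := by
          have h1 : rearr n (x - y) i ≤ 2 * max (rearr n x j) (rearr n y j) := by
            have := rearr_sub_le (x := x) (y := y) hj1 (by omega : 2 * j ≤ i + 1)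
            linarith [le_max_left (rearr n x j) (rearr n y j),
              le_max_right (rearr n x j) (rearr n y j)]
          have h2 : max (rearr n x j) (rearr n y j) ^ v ≤ rearr n x j ^ v + rearr n y j ^ v := by
            rcases max_cases (rearr n x j) (rearr n y j) with h | h <;> rw [h.1]
            · exact le_add_of_nonneg_right (Real.rpow_nonneg (hr _ _) _)
            · exact le_add_of_nonneg_left (Real.rpow_nonneg (hr _ _) _)
          refine (Real.rpow_le_rpow (hr _ _) h1 hv.le).trans ?_
          rw [Real.mul_rpow (by norm_num) ((hr _ _).trans (le_max_left _ _))]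
          gcongr
        refine (mul_le_mul e1 e2 (Real.rpow_nonneg (hr _ _) _) (by positivity)).trans (le_of_eq ?_)
        rw [hg]
        ring
    _ ≤ 2 * ∑ j ∈ Finset.Icc 1 n, g j := by
        refine sum_half_le (fun i => ?_) n
        have := Real.rpow_nonneg (hr x i) v
        have := Real.rpow_nonneg (hr y i) v
        rw [hg]
        positivity
    _ = _ := by
        simp only [hg, ← Finset.mul_sum, Finset.sum_add_distrib, lorentzSum]
        ring

/-- The properties of the source quasi-norm `ℓ_{p,u}` needed for the entropy estimates, with
`θ = 1/u`. -/
structure LorentzLike (p v θ Cw c₁ : ℝ) (NX : (n : ℕ) → (Fin n → ℝ) → ℝ) : Prop where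
  rearr_le : ∀ {n : ℕ} {x : Fin n → ℝ}, NX n x ≤ 1 → ∀ i ∈ Finset.Icc 1 n,
    rearr n x i ≤ Cw * (i : ℝ) ^ (-p⁻¹)
  sum_le : ∀ {n : ℕ} {x : Fin n → ℝ}, NX n x ≤ 1 → ∀ S ⊆ Finset.Icc 1 n,
    ∑ i ∈ S, (i : ℝ) ^ (v / p - 1) * rearr n x i ^ v ≤ (∑ i ∈ S, (i : ℝ)⁻¹) ^ (1 - v * θ)
  le_one : ∀ {n m : ℕ} {x : Fin n → ℝ}, 1 ≤ m → m ≤ n → (∀ i ∈ Finset.Icc 1 n,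
    rearr n x i ≤ c₁ * (1 + Real.log (n / m)) ^ (-θ) *
      min ((m : ℝ) ^ (-p⁻¹)) ((i : ℝ) ^ (-p⁻¹))) → NX n x ≤ 1

lemma one_le_one_add_log {n m : ℕ} (hm : 1 ≤ m) (hmn : m ≤ n) :
    1 ≤ 1 + Real.log ((n : ℝ) / m) := by
  have hm0 : (0 : ℝ) < m := by exact_mod_cast hm
  have : (1 : ℝ) ≤ n / m := by
    rw [one_le_div hm0]
    exact_mod_cast hmn
  linarith [Real.log_nonneg this]

lemma lorentzLike_top {p : ℝ≥0∞} (hp : 0 < p) (hp' : p ≠ ⊤) {v : ℝ} (hv : 0 < v) :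
    LorentzLike p.toReal v 0 1 1 (fun n => lorentzNorm n p ⊤) := by
  have hp0 : 0 < p.toReal := ENNReal.toReal_pos hp.ne' hp'
  have key : ∀ {n : ℕ} {x : Fin n → ℝ}, lorentzNorm n p ⊤ x ≤ 1 → ∀ i ∈ Finset.Icc 1 n,
      rearr n x i ≤ 1 * (i : ℝ) ^ (-p.toReal⁻¹) := by
    intro n x hx i hi
    have hi0 : (0 : ℝ) < i := by exact_mod_cast (Finset.mem_Icc.1 hi).1
    rw [lorentzNorm, if_pos rfl, ENNReal.toReal_div, ENNReal.toReal_one, one_div] at hx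
    have hb : BddAbove {t : ℝ | ∃ i ∈ Finset.Icc 1 n,
        t = (i : ℝ) ^ p.toReal⁻¹ * rearr n x i} := by
      have : {t : ℝ | ∃ i ∈ Finset.Icc 1 n, t = (i : ℝ) ^ p.toReal⁻¹ * rearr n x i} =
          ((Finset.Icc 1 n).image fun i : ℕ => (i : ℝ) ^ p.toReal⁻¹ * rearr n x i : Set ℝ) := by
        ext t
        simp only [Set.mem_ofPred_eq, Finset.coe_image, Set.mem_image, Finset.mem_coe, eq_comm]
      rw [this]
      exact Finset.bddAbove _
    have := (le_csSup hb ⟨i, hi, rfl⟩).trans hx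
    rw [one_mul, Real.rpow_neg hi0.le, ← one_div, le_div_iff₀ (by positivity)]
    linarith
  refine ⟨key, fun {n x} hx S hS => ?_, fun {n m x} hm hmn h => ?_⟩
  · rw [mul_zero, sub_zero, Real.rpow_one]
    refine Finset.sum_le_sum fun i hi => ?_
    have := rpow_mul_le_of_rearr_le (Finset.mem_Icc.1 (hS hi)).1 zero_le_one hv rfl
      (rearr_nonneg n x i) (key hx i (hS hi))
    simpa using this
  · rw [lorentzNorm, if_pos rfl, ENNReal.toReal_div, ENNReal.toReal_one, one_div]
    refine Real.sSup_le ?_ zero_le_one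
    rintro t ⟨i, hi, rfl⟩
    have hi0 : (0 : ℝ) < i := by exact_mod_cast (Finset.mem_Icc.1 hi).1
    have h1 := h i hi
    rw [neg_zero, Real.rpow_zero, one_mul, one_mul] at h1
    have h2 := h1.trans (min_le_right _ _)
    rw [Real.rpow_neg hi0.le, ← one_div, le_div_iff₀ (by positivity)] at h2
    linarith

lemma sum_rpow_mul_rpow_le {S : Finset ℕ} {f g : ℕ → ℝ} {r : ℝ} (hr0 : 0 < r) (hr1 : r < 1)
    (hf : ∀ i ∈ S, 0 ≤ f i) (hg : ∀ i ∈ S, 0 ≤ g i) :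
    ∑ i ∈ S, f i ^ r * g i ^ (1 - r) ≤ (∑ i ∈ S, f i) ^ r * (∑ i ∈ S, g i) ^ (1 - r) := by
  have hpq : (r⁻¹).HolderConjugate (1 - r)⁻¹ := by
    rw [Real.holderConjugate_iff]
    refine ⟨(one_lt_inv₀ hr0).2 hr1, ?_⟩
    rw [inv_inv, inv_inv]
    ring
  have := Real.inner_le_Lp_mul_Lq_of_nonneg S hpq
    (f := fun i => f i ^ r) (g := fun i => g i ^ (1 - r))
    (fun i hi => Real.rpow_nonneg (hf i hi) _) (fun i hi => Real.rpow_nonneg (hg i hi) _)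
  simp only [one_div, inv_inv] at this
  refine this.trans (le_of_eq ?_)
  congr 2
  · exact Finset.sum_congr rfl fun i hi => Real.rpow_rpow_inv (hf i hi) hr0.ne'
  · exact Finset.sum_congr rfl fun i hi => Real.rpow_rpow_inv (hg i hi) (by linarith)

lemma lorentzLike_of_ne_top {p u : ℝ≥0∞} (hp : 0 < p) (hp' : p ≠ ⊤) (hu' : u ≠ ⊤) {v : ℝ}
    (hv : 0 < v) (hvu : v < u.toReal) :
    ∃ Cw c₁ : ℝ, 0 < Cw ∧ 0 < c₁ ∧
      LorentzLike p.toReal v (u.toReal)⁻¹ Cw c₁ (fun n => lorentzNorm n p u) := by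
  have hp0 : 0 < p.toReal := ENNReal.toReal_pos hp.ne' hp'
  have hU : 0 < u.toReal := hv.trans hvu
  have hu : 0 < u := ENNReal.toReal_pos_iff.1 hU |>.1
  have hiff : ∀ (n : ℕ) (x : Fin n → ℝ), lorentzNorm n p u x ≤ 1 ↔
      lorentzSum n (u.toReal / p.toReal) u.toReal x ≤ 1 := fun n x => by
    rw [lorentzNorm_le_iff hu hu' zero_le_one, Real.one_rpow]
  set U := u.toReal
  set P := p.toReal
  have ha : 0 < U / P := by positivity
  set Cb := max 1 (U / P)⁻¹ with hCb
  have hCb0 : 1 ≤ Cb := le_max_left _ _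
  refine ⟨(max 1 (U / P)) ^ U⁻¹, (Cb + 1) ^ (-U⁻¹), by positivity, by positivity, ?_, ?_, ?_⟩
  · intro n x hx i hi
    rw [hiff] at hx
    obtain ⟨hi1, hin⟩ := Finset.mem_Icc.1 hi
    have hi0 : (0 : ℝ) < i := by exact_mod_cast hi1
    have hx0 := rearr_nonneg n x i
    have h1 : (max 1 (U / P))⁻¹ * (i : ℝ) ^ (U / P) * rearr n x i ^ U ≤ 1 :=
      calc _ ≤ (∑ j ∈ Finset.Icc 1 i, (j : ℝ) ^ (U / P - 1)) * rearr n x i ^ U := by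
            gcongr
            exact le_sum_rpow ha i
        _ = ∑ j ∈ Finset.Icc 1 i, (j : ℝ) ^ (U / P - 1) * rearr n x i ^ U := by
            rw [Finset.sum_mul]
        _ ≤ ∑ j ∈ Finset.Icc 1 i, (j : ℝ) ^ (U / P - 1) * rearr n x j ^ U := by
            refine Finset.sum_le_sum fun j hj => ?_
            have := rearr_antitone (x := x) (Finset.mem_Icc.1 hj).1 (Finset.mem_Icc.1 hj).2
            gcongr
        _ ≤ lorentzSum n (U / P) U x :=
            Finset.sum_le_sum_of_subset_of_nonneg (Finset.Icc_subset_Icc_right hin)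
              fun j _ _ => mul_nonneg (by positivity) (Real.rpow_nonneg (rearr_nonneg _ _ _) _)
        _ ≤ 1 := hx
    rw [← Real.rpow_le_rpow_iff hx0 (by positivity) hU,
      Real.mul_rpow (by positivity) (by positivity), ← Real.rpow_mul (by positivity),
      ← Real.rpow_mul hi0.le, inv_mul_cancel₀ hU.ne', Real.rpow_one,
      show -P⁻¹ * U = -(U / P) by field_simp, Real.rpow_neg hi0.le]
    rw [mul_assoc, inv_mul_le_iff₀ (by positivity), mul_one] at h1
    rw [← div_eq_mul_inv, le_div_iff₀ (by positivity)]
    linarith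
  · intro n x hx S hS
    rw [hiff] at hx
    have hr0 : 0 < v / U := by positivity
    have hr1 : v / U < 1 := (div_lt_one hU).2 hvu
    have hxn := rearr_nonneg n x
    have h1 := sum_rpow_mul_rpow_le (S := S) (f := fun i => (i : ℝ) ^ (U / P - 1) * rearr n x i ^ U)
      (g := fun i => (i : ℝ)⁻¹) hr0 hr1
      (fun i _ => mul_nonneg (by positivity) (Real.rpow_nonneg (hxn i) _))
      (fun i _ => by positivity)
    rw [← div_eq_mul_inv]
    refine le_trans (le_of_eq ?_) (h1.trans ?_)
    · refine Finset.sum_congr rfl fun i hi => ?_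
      have hi0 : (0 : ℝ) < i := by exact_mod_cast (Finset.mem_Icc.1 (hS hi)).1
      rw [Real.mul_rpow (by positivity) (Real.rpow_nonneg (hxn i) _), ← Real.rpow_mul hi0.le,
        ← Real.rpow_mul (hxn i), ← Real.rpow_neg_one, ← Real.rpow_mul hi0.le, mul_right_comm,
        ← Real.rpow_add hi0]
      congr 2
      · field_simp
        ring
      · field_simp
    · refine mul_le_of_le_one_left (Real.rpow_nonneg (Finset.sum_nonneg fun _ _ => by positivity) _)
        ?_
      refine Real.rpow_le_one (Finset.sum_nonneg fun i _ => mul_nonneg (by positivity)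
        (Real.rpow_nonneg (hxn i) _)) (le_trans ?_ hx) hr0.le
      exact Finset.sum_le_sum_of_subset_of_nonneg hS
        fun j _ _ => mul_nonneg (by positivity) (Real.rpow_nonneg (hxn _) _)
  · intro n m x hm hmn h
    rw [hiff]
    have hm0 : (0 : ℝ) < m := by exact_mod_cast hm
    have hΛ := one_le_one_add_log hm hmn
    set Λ := 1 + Real.log ((n : ℝ) / m) with hΛd
    set A := (Cb + 1) ^ (-U⁻¹) * Λ ^ (-U⁻¹) with hA
    have hA0 : 0 ≤ A := by positivity
    have hAU : A ^ U = (Cb + 1)⁻¹ * Λ⁻¹ := by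
      rw [hA, Real.mul_rpow (by positivity) (by positivity), ← Real.rpow_mul (by positivity),
        ← Real.rpow_mul (by positivity), neg_mul, inv_mul_cancel₀ hU.ne', Real.rpow_neg_one,
        Real.rpow_neg_one]
    have h1 := sum_rpow_mul_le (n := n) (A := A ^ U) (D := A ^ U * Λ)
      (f := fun i => rearr n x i ^ U) ha hm0 (by positivity)
      (fun i hi => by
        refine (Real.rpow_le_rpow (rearr_nonneg _ _ _) ((h i hi).trans
          (mul_le_mul_of_nonneg_left (min_le_left _ _) hA0)) hU.le).trans (le_of_eq ?_)
        rw [Real.mul_rpow hA0 (by positivity), ← Real.rpow_mul hm0.le]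
        congr 2
        field_simp)
      (by
        refine le_trans (Finset.sum_le_sum fun i hi => rpow_mul_le_of_rearr_le
          (Finset.mem_Icc.1 (Finset.mem_filter.1 hi).1).1 hA0 hU rfl (rearr_nonneg _ _ _)
          ((h i (Finset.mem_filter.1 hi).1).trans
            (mul_le_mul_of_nonneg_left (min_le_right _ _) hA0))) ?_
        rw [← Finset.mul_sum]
        exact mul_le_mul_of_nonneg_left (sum_inv_filter_le (hm.trans hmn) hm0
          (by exact_mod_cast hmn)) (by positivity))
    refine h1.trans ?_
    rw [hAU, ← hCb]
    have : (Cb + 1)⁻¹ * Λ⁻¹ * Cb ≤ (Cb + 1)⁻¹ * Cb := by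
      have : Λ⁻¹ ≤ 1 := inv_le_one_of_one_le₀ hΛ
      calc _ = (Cb + 1)⁻¹ * Cb * Λ⁻¹ := by ring
        _ ≤ _ := mul_le_of_le_one_right (by positivity) this
    calc _ ≤ (Cb + 1)⁻¹ * Cb + (Cb + 1)⁻¹ * Λ⁻¹ * Λ := by linarith
      _ = 1 := by field_simp

end Norms

section UpperBounds

/-- The unit ball of `NX` is covered by `2 ^ (k - 1)` balls of radius `ε` of the Lorentz
quasi-norm with parameters `p, v`, where `a = v / p`. -/
def LorentzCovers (n : ℕ) (NX : (Fin n → ℝ) → ℝ) (a v : ℝ) (k : ℕ) (ε : ℝ) : Prop :=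
  ∃ T : Finset (Fin n → ℝ), T.card ≤ 2 ^ (k - 1) ∧
    ∀ x : Fin n → ℝ, NX x ≤ 1 → ∃ y ∈ T, lorentzSum n a v (x - y) ≤ ε ^ v

lemma LorentzCovers.mono {n : ℕ} {NX : (Fin n → ℝ) → ℝ} {a v ε ε' : ℝ} {k k' : ℕ} (hv : 0 ≤ v)
    (hε : 0 ≤ ε) (h : LorentzCovers n NX a v k ε) (hk : k ≤ k') (hεε : ε ≤ ε') :
    LorentzCovers n NX a v k' ε' := by
  obtain ⟨T, hT, h⟩ := h
  refine ⟨T, hT.trans (Nat.pow_le_pow_right (by norm_num) (by omega)), fun x hx => ?_⟩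
  obtain ⟨y, hy, hxy⟩ := h x hx
  exact ⟨y, hy, hxy.trans (Real.rpow_le_rpow hε hεε hv)⟩

lemma exists_int_toward_zero (y : ℝ) :
    ∃ z : ℤ, |(z : ℝ)| ≤ |y| ∧ |y - z| ≤ 1 ∧ |y - z| ≤ |y| := by
  wlog hy : 0 ≤ y generalizing y
  · obtain ⟨z, h1, h2, h3⟩ := this (-y) (by linarith)
    refine ⟨-z, ?_⟩
    push_cast
    rw [abs_neg] at *
    have e : |y - -(z : ℝ)| = |-y - z| := by rw [← abs_neg]; congr 1; ring
    rw [e]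
    exact ⟨h1, h2, h3⟩
  · have h0 : (0 : ℝ) ≤ ⌊y⌋ := by exact_mod_cast Int.floor_nonneg.2 hy
    have h1 := Int.floor_le y
    have h2 := Int.lt_floor_add_one y
    refine ⟨⌊y⌋, ?_, ?_, ?_⟩
    · rwa [abs_of_nonneg h0, abs_of_nonneg hy]
    · rw [abs_of_nonneg (by linarith)]; linarith
    · rw [abs_of_nonneg (by linarith), abs_of_nonneg hy]; linarith

lemma exists_lattice_approx {n : ℕ} {p Cw h : ℝ} (hp : 0 < p) (hCw : 0 < Cw) (hh : 0 < h)
    {x : Fin n → ℝ} (hx : ∀ i ∈ Finset.Icc 1 n, rearr n x i ≤ Cw * (i : ℝ) ^ (-p⁻¹)) :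
    ∃ z : Fin n → ℤ, WeakBound p ((Cw / h) ^ p) z ∧
      ∀ j, |x j - h * z j| ≤ h ∧ |x j - h * z j| ≤ |x j| := by
  choose z hz1 hz2 hz3 using fun j => exists_int_toward_zero (x j / h)
  have e : ∀ j, |x j - h * z j| = h * |x j / h - z j| := fun j => by
    rw [← abs_of_pos hh, ← abs_mul, abs_of_pos hh]
    congr 1
    field_simp
  have e' : ∀ j, |x j| = h * |x j / h| := fun j => by
    rw [abs_div, abs_of_pos hh]
    field_simp
  refine ⟨z, fun j hj => ?_, fun j => ⟨?_, ?_⟩⟩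
  · set A := (Finset.univ : Finset (Fin n)).filter (fun i => |z j| ≤ |z i|) with hA
    have hA1 : 1 ≤ A.card := Finset.card_pos.2 ⟨j, by simp [hA]⟩
    have hAn : A.card ≤ n := by simpa using Finset.card_le_univ A
    have h1 : h * |(z j : ℝ)| ≤ rearr n x A.card := by
      refine le_rearr hA1 (Finset.card_le_card fun i hi => ?_)
      simp only [Finset.mem_filter, Finset.mem_univ, true_and]
      rw [e' i]
      refine mul_le_mul_of_nonneg_left (le_trans ?_ (hz1 i)) hh.le
      exact_mod_cast (Finset.mem_filter.1 hi).2
    have h2 := h1.trans (hx _ (Finset.mem_Icc.2 ⟨hA1, hAn⟩))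
    have hA0 : (0 : ℝ) < A.card := by exact_mod_cast hA1
    have h3 : |(z j : ℝ)| ≤ Cw / h * (A.card : ℝ) ^ (-p⁻¹) := by
      rw [div_mul_eq_mul_div, le_div_iff₀ hh]
      linarith
    have h4 := Real.rpow_le_rpow (abs_nonneg _) h3 hp.le
    rw [Real.mul_rpow (by positivity) (by positivity), ← Real.rpow_mul hA0.le, neg_mul,
      inv_mul_cancel₀ hp.ne', Real.rpow_neg_one, ← div_eq_mul_inv, le_div_iff₀ hA0] at h4
    linarith
  · rw [e]
    exact mul_le_of_le_one_right hh.le (hz2 j)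
  · rw [e, e']
    exact mul_le_mul_of_nonneg_left (hz3 j) hh.le

lemma exists_lorentzCovers_of_le {p v θ Cw c₁ : ℝ} {NX : (n : ℕ) → (Fin n → ℝ) → ℝ}
    (hNX : LorentzLike p v θ Cw c₁ NX) (hp : 0 < p) (hv : 0 < v) (hCw : 0 < Cw)
    (hvθ : v * θ < 1) :
    ∃ C : ℝ, 0 < C ∧ ∀ n k : ℕ, 1 ≤ k → k ≤ n →
      LorentzCovers n (NX n) (v / p) v k (C * (1 + Real.log (n / k)) ^ (1 / v - θ)) := by
  set c₀ : ℝ := (10 * (40 + 2 / p))⁻¹ with hc₀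
  have hp2 : 0 < 2 / p := by positivity
  have hc0 : 0 < c₀ := by positivity
  have hc1 : c₀ ≤ 1 / 400 := by
    rw [hc₀, one_div]
    exact inv_anti₀ (by norm_num) (by linarith)
  set Q := Cw ^ v * max 1 (v / p)⁻¹ + (2 + c₀⁻¹) ^ (1 - v * θ) with hQ
  have hQ0 : 0 < Q := by positivity
  refine ⟨Q ^ v⁻¹, by positivity, fun n k hk hkn => ?_⟩
  have hk0 : (0 : ℝ) < k := by exact_mod_cast hk
  have hn1 : 1 ≤ n := hk.trans hkn
  have hn0 : (0 : ℝ) < n := by exact_mod_cast hn1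
  have hknR : (k : ℝ) ≤ n := by exact_mod_cast hkn
  have hL := one_le_one_add_log hk hkn
  set L := 1 + Real.log ((n : ℝ) / k) with hLd
  have hL0 : 0 < L := by linarith
  set N := c₀ * k / L with hN
  have hN0 : 0 < N := by positivity
  have hNL : N * L = c₀ * k := by rw [hN]; field_simp
  have hNk : N ≤ c₀ * k := by rw [← hNL]; exact le_mul_of_one_le_right hN0.le hL
  have hNn : N ≤ n := hNk.trans (by nlinarith)
  set h := Cw * N ^ (-p⁻¹) with hh
  have hh0 : 0 < h := by positivity
  have hCh : (Cw / h) ^ p = N := by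
    have : Cw / h = N ^ p⁻¹ := by
      rw [hh, Real.rpow_neg hN0.le]
      have := (Real.rpow_pos_of_pos hN0 p⁻¹).ne'
      field_simp
    rw [this, Real.rpow_inv_rpow hN0.le hp.ne']
  obtain ⟨F, hF⟩ := exists_finset_weakBound (n := n) hp hN0.le
  have hcard : F.card ≤ 2 ^ (k - 1) := by
    rcases lt_or_ge N 1 with h1 | h1
    · refine le_trans (Finset.card_le_one.2 fun a ha b hb => ?_) Nat.one_le_two_pow
      rw [((hF a).1 ha).eq_zero hp h1, ((hF b).1 hb).eq_zero hp h1]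
    · have hk2 : (2 : ℝ) ≤ k := by nlinarith
      have hδ : (0 : ℝ) < k / (40 * n) := by positivity
      have hδ1 : (k : ℝ) / (40 * n) ≤ 1 := by
        rw [div_le_one (by positivity)]; linarith
      have h2 := card_le_of_weakBound hp hN0.le hδ hδ1 F fun z hz => (hF z).1 hz
      have h3 : ((k : ℝ) / (40 * n)) ^ (-N) = Real.exp (N * Real.log (40 * (n / k))) := by
        rw [Real.rpow_def_of_pos hδ, show (k : ℝ) / (40 * n) = (40 * ((n : ℝ) / k))⁻¹ by field_simp,
          Real.log_inv]
        congr 1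
        ring
      rw [h3, ← Real.exp_add, ← Real.exp_add, Real.log_mul (by norm_num) (by positivity)] at h2
      have h4 : Real.log 40 ≤ 39 := by
        have := Real.log_le_sub_one_of_pos (show (0 : ℝ) < 40 by norm_num)
        linarith
      have h5 : 4 * ((k : ℝ) / (40 * n)) * n = k / 10 := by field_simp; ring
      have h6 : N * (Real.log 40 + Real.log (n / k)) ≤ 40 * (c₀ * k) := by
        calc N * (Real.log 40 + Real.log (n / k)) ≤ N * (40 * L) := by
              gcongr
              linarith
          _ = _ := by rw [← hNL]; ring
      have h7 : 2 * N / p ≤ 2 / p * (c₀ * k) := by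
        rw [mul_div_right_comm]
        gcongr
      have h8 : 40 * (c₀ * k) + 2 / p * (c₀ * k) = (k : ℝ) / 10 := by
        rw [← add_mul, hc₀]
        field_simp
      have h9 : ((k - 1 : ℕ) : ℝ) = k - 1 := by
        push_cast [Nat.cast_sub hk]
        ring
      have h10 : (F.card : ℝ) ≤ 2 ^ (k - 1) := by
        refine h2.trans ?_
        rw [← Real.rpow_natCast, h9, Real.rpow_def_of_pos (by norm_num), Real.exp_le_exp, h5]
        nlinarith [Real.log_two_gt_d9]
      exact_mod_cast h10
  refine ⟨F.image fun z j => h * (z j : ℝ), Finset.card_image_le.trans hcard, fun x hx => ?_⟩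
  have hxr := hNX.rearr_le hx
  obtain ⟨z, hz, hzx⟩ := exists_lattice_approx hp hCw hh0 hxr
  rw [hCh] at hz
  refine ⟨_, Finset.mem_image_of_mem _ ((hF z).2 hz), ?_⟩
  set e : Fin n → ℝ := x - fun j => h * (z j : ℝ) with he
  have he1 : ∀ i, rearr n e i ≤ h := fun i => rearr_le_of_forall hh0.le fun j => (hzx j).1
  have he2 : ∀ i, 1 ≤ i → rearr n e i ≤ rearr n x i := fun i hi =>
    rearr_mono hi fun j => (hzx j).2
  have hlog : 1 + Real.log (n / N) ≤ (2 + c₀⁻¹) * L := by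
    have e1 : (n : ℝ) / N = (n / k) * (L * c₀⁻¹) := by rw [hN]; field_simp
    rw [e1, Real.log_mul (by positivity) (by positivity), Real.log_mul (by positivity)
      (by positivity)]
    have := Real.log_le_sub_one_of_pos hL0
    have h3 := Real.log_le_sub_one_of_pos (inv_pos.2 hc0)
    have h4 : c₀⁻¹ ≤ c₀⁻¹ * L := le_mul_of_one_le_right (by positivity) hL
    linarith
  have hlog0 : 0 ≤ Real.log ((n : ℝ) / N) :=
    Real.log_nonneg (by rw [one_le_div hN0]; exact hNn)
  have h1 := sum_rpow_mul_le (n := n) (a := v / p) (N := N) (A := Cw ^ v)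
    (D := ((2 + c₀⁻¹) * L) ^ (1 - v * θ)) (f := fun i => rearr n e i ^ v) (by positivity) hN0
    (by positivity)
    (fun i _ => by
      refine (Real.rpow_le_rpow (rearr_nonneg _ _ _) (he1 i) hv.le).trans (le_of_eq ?_)
      rw [hh, Real.mul_rpow hCw.le (by positivity), ← Real.rpow_mul hN0.le]
      congr 2
      field_simp)
    (by
      refine le_trans (Finset.sum_le_sum fun i hi => ?_) ((hNX.sum_le hx _
        (Finset.filter_subset _ _)).trans (Real.rpow_le_rpow (Finset.sum_nonneg fun _ _ =>
          by positivity) ((sum_inv_filter_le hn1 hN0 hNn).trans hlog) (by linarith)))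
      have := he2 i (Finset.mem_Icc.1 (Finset.mem_filter.1 hi).1).1
      have := rearr_nonneg n e i
      gcongr)
  refine h1.trans ?_
  have e2 : (Q ^ v⁻¹ * L ^ (1 / v - θ)) ^ v = Q * L ^ (1 - v * θ) := by
    rw [Real.mul_rpow (by positivity) (by positivity), Real.rpow_inv_rpow hQ0.le hv.ne',
      ← Real.rpow_mul hL0.le]
    congr 2
    field_simp
  rw [e2, Real.mul_rpow (by positivity) hL0.le, hQ, add_mul]
  exact add_le_add_left (le_mul_of_one_le_right (by positivity)
    (Real.one_le_rpow hL (sub_nonneg.2 hvθ.le))) _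

lemma exists_lorentzCovers_of_pow_le {p v θ Cw c₁ : ℝ} {NX : (n : ℕ) → (Fin n → ℝ) → ℝ}
    (hNX : LorentzLike p v θ Cw c₁ NX) (hp : 0 < p) (hv : 0 < v) (hCw : 0 < Cw) :
    ∃ C : ℝ, 0 < C ∧ ∀ n k M : ℕ, 1 ≤ n → 1 ≤ M →
      (Real.exp (4 + 2 / p) * (3 * M)) ^ n ≤ 2 ^ (k - 1) →
      LorentzCovers n (NX n) (v / p) v k (C / M) := by
  have ha : 0 < v / p := by positivity
  set Cb := max 1 (v / p)⁻¹ with hCb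
  have hCb0 : 1 ≤ Cb := le_max_left _ _
  refine ⟨Cb ^ v⁻¹ * Cw, by positivity, fun n k M hn hM hk => ?_⟩
  have hn0 : (0 : ℝ) < n := by exact_mod_cast hn
  have hM0 : (0 : ℝ) < M := by exact_mod_cast hM
  set h := Cw * (n : ℝ) ^ (-p⁻¹) with hh
  have hh0 : 0 < h := by positivity
  have hCh : (Cw / h) ^ p = n := by
    have : Cw / h = (n : ℝ) ^ p⁻¹ := by
      rw [hh, Real.rpow_neg hn0.le]
      have := (Real.rpow_pos_of_pos hn0 p⁻¹).ne'
      field_simp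
    rw [this, Real.rpow_inv_rpow hn0.le hp.ne']
  obtain ⟨F, hF⟩ := exists_finset_weakBound (n := n) (N := (n : ℝ)) hp hn0.le
  set D := Fintype.piFinset fun _ : Fin n => Finset.Icc (-(M : ℤ)) M with hD
  have hFc : (F.card : ℝ) ≤ Real.exp (4 + 2 / p) ^ n := by
    have := card_le_of_weakBound hp hn0.le one_pos le_rfl F fun z hz => (hF z).1 hz
    rw [Real.one_rpow, mul_one, ← Real.exp_add] at this
    refine this.trans (le_of_eq ?_)
    rw [← Real.exp_nat_mul]
    congr 1
    ring
  have hDc : (D.card : ℝ) ≤ (3 * M) ^ n := by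
    rw [hD, Fintype.card_piFinset_const, Int.card_Icc]
    have : ((M : ℤ) + 1 - -(M : ℤ)).toNat = 2 * M + 1 := by omega
    rw [this]
    push_cast
    have : (1 : ℝ) ≤ M := by exact_mod_cast hM
    gcongr
    linarith
  refine ⟨(F ×ˢ D).image fun q j => h * (q.1 j : ℝ) + h / M * (q.2 j : ℝ), ?_, fun x hx => ?_⟩
  · refine Finset.card_image_le.trans ?_
    rw [Finset.card_product]
    have : (F.card : ℝ) * D.card ≤ 2 ^ (k - 1) := by
      refine le_trans ?_ hk
      rw [mul_pow]
      gcongr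
    exact_mod_cast this
  · obtain ⟨z, hz, hzx⟩ := exists_lattice_approx hp hCw hh0 (hNX.rearr_le hx)
    rw [hCh] at hz
    choose w hw1 hw2 _ using fun j => exists_int_toward_zero ((x j - h * z j) / (h / M))
    have hwD : w ∈ D := by
      rw [hD, Fintype.mem_piFinset]
      intro j
      rw [Finset.mem_Icc, ← abs_le]
      have h1 : |(w j : ℝ)| ≤ M := by
        refine (hw1 j).trans ?_
        rw [abs_div, abs_of_pos (by positivity : 0 < h / M), div_le_iff₀ (by positivity)]
        refine (hzx j).1.trans (le_of_eq ?_)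
        field_simp
      exact_mod_cast h1
    refine ⟨_, Finset.mem_image_of_mem _ (Finset.mk_mem_product ((hF z).2 hz) hwD), ?_⟩
    set e : Fin n → ℝ := x - fun j => h * (z j : ℝ) + h / M * (w j : ℝ) with he
    have he1 : ∀ i, rearr n e i ≤ h / M := fun i => by
      refine rearr_le_of_forall (by positivity) fun j => ?_
      have e1 : e j = h / M * ((x j - h * z j) / (h / M) - w j) := by
        simp only [he, Pi.sub_apply]
        field_simp
        ring
      rw [e1, abs_mul, abs_of_pos (by positivity : 0 < h / M)]
      exact mul_le_of_le_one_right (by positivity) (hw2 j)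
    calc lorentzSum n (v / p) v e
        ≤ ∑ i ∈ Finset.Icc 1 n, (i : ℝ) ^ (v / p - 1) * (h / M) ^ v := by
          refine Finset.sum_le_sum fun i _ => ?_
          have := rearr_nonneg n e i
          gcongr
          exact he1 i
      _ ≤ Cb * (n : ℝ) ^ (v / p) * (h / M) ^ v := by
          rw [← Finset.sum_mul]
          gcongr
          exact sum_rpow_le ha n
      _ = (Cb ^ v⁻¹ * Cw / M) ^ v := by
          have e1 : h / M = Cw / M * (n : ℝ) ^ (-p⁻¹) := by rw [hh]; ring
          rw [e1, Real.mul_rpow (by positivity) (by positivity), ← Real.rpow_mul hn0.le,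
            mul_div_assoc, Real.mul_rpow (by positivity) (by positivity),
            Real.rpow_inv_rpow (by positivity) hv.ne']
          have e2 : (n : ℝ) ^ (v / p) * (n : ℝ) ^ (-p⁻¹ * v) = 1 := by
            rw [← Real.rpow_add hn0, show v / p + -p⁻¹ * v = 0 by ring, Real.rpow_zero]
          calc _ = Cb * (Cw / M) ^ v * ((n : ℝ) ^ (v / p) * (n : ℝ) ^ (-p⁻¹ * v)) := by ring
            _ = _ := by rw [e2, mul_one]

end UpperBounds

section LowerBound

/-- Spread `z : ℝ^m` over `ℝ^n` periodically, damping the `r`-th period by `(m * r) ^ (-1/p)`. -/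
noncomputable def spread (n : ℕ) {m : ℕ} (p : ℝ) (hm : 0 < m) (z : Fin m → ℝ) : Fin n → ℝ :=
  fun j => ((m : ℝ) * (((j : ℕ) / m : ℕ) + 1)) ^ (-p⁻¹) * z ⟨(j : ℕ) % m, Nat.mod_lt _ hm⟩

lemma rearr_spread_le {n m : ℕ} {p D : ℝ} (hp : 0 < p) (hm : 0 < m) {z : Fin m → ℝ}
    (hD : 0 ≤ D) (hz : ∀ l, |z l| ≤ D) {i : ℕ} (hi : 1 ≤ i) :
    rearr n (spread n p hm z) i ≤ D * min ((m : ℝ) ^ (-p⁻¹)) ((i : ℝ) ^ (-p⁻¹)) := by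
  have hm0 : (0 : ℝ) < m := by exact_mod_cast hm
  have hi0 : (0 : ℝ) < i := by exact_mod_cast hi
  have hp' : -p⁻¹ < 0 := by simpa using hp
  have habs : ∀ j : Fin n, |spread n p hm z j| ≤
      D * ((m : ℝ) * (((j : ℕ) / m : ℕ) + 1)) ^ (-p⁻¹) := fun j => by
    rw [spread, abs_mul, abs_of_nonneg (by positivity), mul_comm]
    exact mul_le_mul_of_nonneg_right (hz _) (by positivity)
  rw [mul_min_of_nonneg _ _ hD]
  refine le_min (rearr_le_of_forall (by positivity) fun j => (habs j).trans ?_)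
    (rearr_le (by positivity) ?_)
  · refine mul_le_mul_of_nonneg_left (Real.rpow_le_rpow_of_nonpos hm0 ?_ hp'.le) hD
    exact le_mul_of_one_le_right hm0.le (by simp)
  · calc _ ≤ (Finset.range (i - 1)).card := by
          refine Finset.card_le_card_of_injOn (fun j : Fin n => (j : ℕ)) (fun j hj => ?_)
            (fun _ _ _ _ h => Fin.ext h)
          simp only [Finset.coe_filter, Finset.mem_univ, true_and, Set.mem_ofPred_eq] at hj
          simp only [Finset.coe_range, Set.mem_Iio]
          by_contra hc
          have h1 : i ≤ m * ((j : ℕ) / m + 1) := by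
            have := Nat.lt_mul_div_succ (j : ℕ) hm
            omega
          have h2 : (i : ℝ) ≤ (m : ℝ) * (((j : ℕ) / m : ℕ) + 1) := by exact_mod_cast h1
          have h3 := Real.rpow_le_rpow_of_nonpos hi0 h2 hp'.le
          have h4 := (habs j).trans (mul_le_mul_of_nonneg_left h3 hD)
          linarith
      _ = i - 1 := Finset.card_range _

lemma le_rearr_spread {n m : ℕ} {p τ : ℝ} (hp : 0 < p) (hm : 0 < m) {y : Fin m → ℝ}
    (hτ : 0 < τ) {r i : ℕ} (hi : 1 ≤ i) (hrn : r ≤ n / m)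
    (hir : i ≤ ((Finset.univ : Finset (Fin m)).filter (fun l => τ ≤ |y l|)).card * r) :
    τ * ((m : ℝ) * r) ^ (-p⁻¹) ≤ rearr n (spread n p hm y) i := by
  have hm0 : (0 : ℝ) < m := by exact_mod_cast hm
  have hp' : -p⁻¹ < 0 := by simpa using hp
  set A := (Finset.univ : Finset (Fin m)).filter (fun l => τ ≤ |y l|) with hA
  refine le_rearr hi (hir.trans ?_)
  have hcard : A.card * r = (A ×ˢ Finset.range r).card := by
    rw [Finset.card_product, Finset.card_range]
  rw [hcard]
  refine Finset.card_le_card_of_surjOn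
    (fun j : Fin n => ((⟨(j : ℕ) % m, Nat.mod_lt _ hm⟩ : Fin m), (j : ℕ) / m)) ?_
  rintro ⟨l, t⟩ hlt
  simp only [Finset.coe_product, Set.mem_prod, Finset.mem_coe, Finset.mem_range] at hlt
  obtain ⟨hl, ht⟩ := hlt
  have hl' : τ ≤ |y l| := (Finset.mem_filter.1 hl).2
  have hlt : l.1 + m * t < n := by
    have h1 : m * (t + 1) ≤ m * (n / m) := Nat.mul_le_mul_left _ (by omega)
    have h2 := Nat.mul_div_le n m
    have h3 := l.2
    rw [mul_add] at h1
    omega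
  have e1 : (l.1 + m * t) % m = l.1 := by
    rw [Nat.add_mul_mod_self_left, Nat.mod_eq_of_lt l.2]
  have e2 : (l.1 + m * t) / m = t := by
    rw [Nat.add_mul_div_left _ _ hm, Nat.div_eq_of_lt l.2, zero_add]
  refine ⟨⟨l.1 + m * t, hlt⟩, ?_, ?_⟩
  · rw [Finset.mem_coe, Finset.mem_filter_univ]
    simp only [spread, e1, e2]
    rw [abs_mul, abs_of_nonneg (by positivity), mul_comm τ]
    refine mul_le_mul (Real.rpow_le_rpow_of_nonpos (by positivity) ?_ hp'.le) hl' hτ.le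
      (by positivity)
    gcongr
    exact_mod_cast ht
  · simp only [e1, e2]

lemma exists_le_lorentzSum_spread {p v : ℝ} (hp : 0 < p) (hv : 0 < v) :
    ∃ c : ℝ, 0 < c ∧ ∀ (n m a : ℕ) (hm : 0 < m) (y : Fin m → ℝ) (τ : ℝ), m ≤ n → 0 < τ →
      1 ≤ a → a = ((Finset.univ : Finset (Fin m)).filter (fun l => τ ≤ |y l|)).card →
      c * ((a : ℝ) / m) ^ (v / p) * τ ^ v * (1 + Real.log (n / m)) ≤
        lorentzSum n (v / p) v (spread n p hm y) := by
  have hb : 0 < v / p := by positivity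
  set b := v / p with hbd
  set d := min (max 1 b)⁻¹ (2 ^ (-b)) with hd
  have hd0 : 0 < d := lt_min (by positivity) (by positivity)
  refine ⟨d / 3, by positivity, fun n m a hm y τ hmn hτ ha hcard => ?_⟩
  have hm0 : (0 : ℝ) < m := by exact_mod_cast hm
  have ha0 : (0 : ℝ) < a := by exact_mod_cast ha
  have ham : a ≤ m := by
    rw [hcard]
    exact (Finset.card_filter_le _ _).trans_eq (by simp)
  set B := n / m with hB
  have hB1 : 1 ≤ B := (Nat.one_le_div_iff hm).2 hmn
  have hB0 : (0 : ℝ) < B := by exact_mod_cast hB1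
  have haB : a ≤ a * B := Nat.le_mul_of_pos_right _ hB1
  have haBn : a * B ≤ n := (Nat.mul_le_mul_right B ham).trans (Nat.mul_div_le n m)
  set w := spread n p hm y with hw
  have hw0 := rearr_nonneg n w
  set P := ((a : ℝ) / m) ^ b * τ ^ v with hP
  have hP0 : 0 < P := by positivity
  have h1 : ∀ i ∈ Finset.Icc 1 a, (i : ℝ) ^ (b - 1) * ((m : ℝ) ^ (-b) * τ ^ v) ≤
      (i : ℝ) ^ (b - 1) * rearr n w i ^ v := fun i hi => by
    obtain ⟨hi1, hia⟩ := Finset.mem_Icc.1 hi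
    have := le_rearr_spread (n := n) (y := y) hp hm hτ hi1 hB1
      (by rw [mul_one, ← hcard]; exact hia)
    rw [Nat.cast_one, mul_one] at this
    refine mul_le_mul_of_nonneg_left (le_trans (le_of_eq ?_)
      (Real.rpow_le_rpow (by positivity) this hv.le)) (by positivity)
    rw [Real.mul_rpow hτ.le (by positivity), ← Real.rpow_mul hm0.le, mul_comm, hbd]
    congr 2
    ring
  have h2 : ∀ i ∈ Finset.Ioc a (a * B), 2 ^ (-b) * P * (i : ℝ)⁻¹ ≤
      (i : ℝ) ^ (b - 1) * rearr n w i ^ v := fun i hi => by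
    obtain ⟨hia, hiB⟩ := Finset.mem_Ioc.1 hi
    have hi0 : (0 : ℝ) < i := by exact_mod_cast (by omega : 0 < i)
    obtain ⟨r, hr⟩ : ∃ r, r = (i - 1) / a + 1 := ⟨_, rfl⟩
    have hir : i ≤ a * r := by
      have := Nat.lt_mul_div_succ (i - 1) (by omega : 0 < a)
      rw [hr]
      omega
    have hrB : r ≤ B := by
      rw [hr]
      exact Nat.div_lt_of_lt_mul (by omega)
    have hr0 : (0 : ℝ) < r := by
      rw [hr]
      positivity
    have hr2 : (r : ℝ) ≤ 2 * i / a := by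
      rw [le_div_iff₀ ha0]
      have h3 : (i - 1) / a * a ≤ i - 1 := Nat.div_mul_le_self _ _
      have h4 : r * a ≤ 2 * i := by
        rw [hr, add_mul, one_mul]
        linarith [Nat.sub_le i 1]
      exact_mod_cast h4
    have h5 := le_rearr_spread (n := n) (y := y) hp hm hτ (by omega : 1 ≤ i) hrB
      (by rw [← hcard]; exact hir)
    have h6 : τ * ((m : ℝ) * (2 * i / a)) ^ (-p⁻¹) ≤ rearr n w i := by
      refine le_trans (mul_le_mul_of_nonneg_left (Real.rpow_le_rpow_of_nonpos (by positivity)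
        (by gcongr) ?_) hτ.le) h5
      simpa using hp.le
    refine le_trans (le_of_eq ?_) (mul_le_mul_of_nonneg_left
      (Real.rpow_le_rpow (by positivity) h6 hv.le) (by positivity))
    rw [Real.mul_rpow hτ.le (by positivity), ← Real.rpow_mul (by positivity),
      show -p⁻¹ * v = -b by rw [hbd]; ring,
      show (m : ℝ) * (2 * (i : ℝ) / a) = 2 * (i : ℝ) * ((a : ℝ) / m)⁻¹ by field_simp,
      Real.mul_rpow (by positivity) (by positivity), Real.mul_rpow (by positivity) (by positivity),
      Real.inv_rpow (by positivity), Real.rpow_neg (x := (a : ℝ) / m) (by positivity), inv_inv,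
      Real.rpow_neg hi0.le, Real.rpow_sub_one hi0.ne', hP]
    have := (Real.rpow_pos_of_pos hi0 b).ne'
    field_simp
  have h3 : d * P ≤ ∑ i ∈ Finset.Icc 1 a, (i : ℝ) ^ (b - 1) * rearr n w i ^ v := by
    refine le_trans ?_ (Finset.sum_le_sum h1)
    rw [← Finset.sum_mul]
    calc d * P ≤ (max 1 b)⁻¹ * P := by
          gcongr
          exact min_le_left _ _
      _ = (max 1 b)⁻¹ * (a : ℝ) ^ b * ((m : ℝ) ^ (-b) * τ ^ v) := by
          rw [hP, Real.div_rpow ha0.le hm0.le, Real.rpow_neg hm0.le]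
          ring
      _ ≤ _ := by
          gcongr
          exact le_sum_rpow hb a
  set X := ∑ i ∈ Finset.Ioc a (a * B), (i : ℝ)⁻¹ with hX
  have hX0 : 0 ≤ X := Finset.sum_nonneg fun _ _ => by positivity
  have h4 : d * P * X ≤ ∑ i ∈ Finset.Ioc a (a * B), (i : ℝ) ^ (b - 1) * rearr n w i ^ v := by
    refine le_trans ?_ (Finset.sum_le_sum h2)
    rw [← Finset.mul_sum]
    gcongr
    exact min_le_right _ _
  have h5 : d * P + d * P * X ≤ lorentzSum n b v w := by
    refine (add_le_add h3 h4).trans ?_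
    have e1 : Finset.Icc 1 a = Finset.Ioc 0 a := by
      ext
      simp [Nat.one_le_iff_ne_zero, Nat.pos_iff_ne_zero]
    rw [e1, Finset.sum_Ioc_consecutive _ (Nat.zero_le _) haB]
    refine Finset.sum_le_sum_of_subset_of_nonneg (fun i hi => ?_) fun i _ _ =>
      mul_nonneg (by positivity) (Real.rpow_nonneg (hw0 _) _)
    have := Finset.mem_Ioc.1 hi
    exact Finset.mem_Icc.2 ⟨this.1, this.2.trans haBn⟩
  have h6 : 1 + Real.log (n / m) ≤ 3 * (1 + X) := by
    have hl := log_le_sum_Ioc_inv haB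
    have h7 : Real.log a + Real.log B ≤ Real.log ((a * B : ℕ) + 1) := by
      rw [← Real.log_mul ha0.ne' hB0.ne']
      refine Real.log_le_log (by positivity) ?_
      push_cast
      linarith
    have h8 : Real.log (a + 1) ≤ Real.log 2 + Real.log a := by
      rw [← Real.log_mul (by norm_num) ha0.ne']
      refine Real.log_le_log (by positivity) ?_
      have : (1 : ℝ) ≤ a := by exact_mod_cast ha
      linarith
    have h9 : Real.log (n / m) ≤ Real.log 2 + Real.log B := by
      rw [← Real.log_mul (by norm_num) hB0.ne']
      have hn0 : (0 : ℝ) < n := by exact_mod_cast (by omega : 0 < n)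
      refine Real.log_le_log (by positivity) ?_
      rw [div_le_iff₀ hm0]
      have h10 : n < m * (B + 1) := Nat.lt_mul_div_succ n hm
      have h11 : m * (B + 1) ≤ 2 * B * m := by nlinarith
      exact_mod_cast (by omega : n ≤ 2 * B * m)
    linarith [Real.log_two_lt_d9]
  calc d / 3 * ((a : ℝ) / m) ^ b * τ ^ v * (1 + Real.log (n / m))
      = d / 3 * P * (1 + Real.log (n / m)) := by rw [hP]; ring
    _ ≤ d / 3 * P * (3 * (1 + X)) := by gcongr
    _ = d * P + d * P * X := by ring
    _ ≤ _ := h5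

lemma exists_le_of_lorentzCovers {p v θ Cw c₁ : ℝ} {NX : (n : ℕ) → (Fin n → ℝ) → ℝ}
    (hNX : LorentzLike p v θ Cw c₁ NX) (hp : 0 < p) (hv : 0 < v) (hc₁ : 0 < c₁) :
    ∃ c : ℝ, 0 < c ∧ ∀ (n m k : ℕ) (ε : ℝ), 1 ≤ m → m ≤ n → 1 ≤ k → 0 < ε →
      LorentzCovers n (NX n) (v / p) v k ε →
      c * (1 + Real.log (n / m)) ^ (1 / v - θ) * 2 ^ (-(k : ℝ) / m) ≤ ε := by
  obtain ⟨c₂, hc₂, hlow⟩ := exists_le_lorentzSum_spread hp hv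
  have hb : 0 < v / p := by positivity
  set K : ℝ := 2 * (2 ^ (v / p) * 2 ^ v) with hK
  have hK0 : 0 < K := by positivity
  set C₀ := Real.exp (4 + 2 / p) with hC₀
  have hC₀1 : 1 ≤ C₀ := Real.one_le_exp (by positivity)
  set c₃ := c₁ * (c₂ / (2 * K)) ^ v⁻¹ with hc₃
  have hc₃0 : 0 < c₃ := by positivity
  refine ⟨c₃ / (2 * C₀), by positivity, fun n m k ε hm hmn hk hε hcov => ?_⟩
  have hm0 : (0 : ℝ) < m := by exact_mod_cast hm
  have hΛ := one_le_one_add_log hm hmn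
  set Λ := 1 + Real.log ((n : ℝ) / m) with hΛd
  have hΛ0 : 0 < Λ := by linarith
  set E : ℝ := 2 ^ ((k : ℝ) / m) with hE
  have hE1 : 1 ≤ E := Real.one_le_rpow (by norm_num) (by positivity)
  have hEm : E ^ m = 2 ^ k := by
    rw [hE, ← Real.rpow_mul_natCast (by norm_num), div_mul_cancel₀ _ hm0.ne', Real.rpow_natCast]
  obtain ⟨M, hM⟩ : ∃ M, M = ⌈C₀ * E⌉₊ := ⟨_, rfl⟩
  have hCE : 1 ≤ C₀ * E := one_le_mul_of_one_le_of_one_le hC₀1 hE1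
  have hM1 : C₀ * E ≤ M := by rw [hM]; exact Nat.le_ceil _
  have hM2 : (M : ℝ) ≤ 2 * (C₀ * E) := by
    have := Nat.ceil_lt_add_one (zero_le_one.trans hCE)
    rw [← hM] at this
    linarith
  have hM0 : (0 : ℝ) < M := by linarith
  suffices hmain : c₃ * Λ ^ (1 / v - θ) / M ≤ ε by
    refine le_trans ?_ hmain
    rw [neg_div, Real.rpow_neg (by norm_num), ← hE]
    calc c₃ / (2 * C₀) * Λ ^ (1 / v - θ) * E⁻¹ = c₃ * Λ ^ (1 / v - θ) / (2 * (C₀ * E)) := by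
          field_simp
      _ ≤ _ := by gcongr
  by_contra! hlt
  obtain ⟨T, hT, hcov⟩ := hcov
  set κ := c₁ * Λ ^ (-θ) / M with hκ
  have hκ0 : 0 < κ := by positivity
  set G : (Fin m → ℤ) → Fin n → ℝ := fun z => spread n p hm fun l => κ * (z l : ℝ) with hG
  set Z := Fintype.piFinset fun _ : Fin m => Finset.Icc (1 : ℤ) M with hZ
  have hZc : Z.card = M ^ m := by
    rw [hZ, Fintype.card_piFinset_const, Int.card_Icc]
    simp
  have hball : ∀ z ∈ Z, NX n (G z) ≤ 1 := fun z hz => by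
    refine hNX.le_one hm hmn fun i hi => rearr_spread_le hp hm (by positivity) (fun l => ?_)
      (Finset.mem_Icc.1 hi).1
    rw [hZ, Fintype.mem_piFinset] at hz
    obtain ⟨h1, h2⟩ := Finset.mem_Icc.1 (hz l)
    have h3 : |(z l : ℝ)| ≤ M := by
      rw [← Int.cast_abs, abs_of_pos (by omega)]
      exact_mod_cast h2
    rw [abs_mul, abs_of_pos hκ0, hκ]
    calc _ ≤ c₁ * Λ ^ (-θ) / M * M := by gcongr
      _ = c₁ * (1 + Real.log (n / m)) ^ (-θ) := div_mul_cancel₀ _ hM0.ne'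
  choose! f hfT hfε using fun z (hz : z ∈ Z) => hcov (G z) (hball z hz)
  have hfib : ∀ y ∈ T, ((Z.filter fun z => f z = y).card : ℝ) ≤ C₀ ^ m := by
    intro y _
    rcases (Z.filter fun z => f z = y).eq_empty_or_nonempty with h0 | ⟨z₀, hz₀⟩
    · rw [h0]
      simp only [Finset.card_empty, Nat.cast_zero]
      positivity
    obtain ⟨hz₀Z, hz₀y⟩ := Finset.mem_filter.1 hz₀
    rw [← Finset.card_image_of_injective _ (sub_left_injective (b := z₀))]
    refine (card_le_of_weakBound (N := (m : ℝ)) hp hm0.le one_pos le_rfl _ ?_).trans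
      (le_of_eq ?_)
    · intro q hq
      obtain ⟨z, hz, rfl⟩ := Finset.mem_image.1 hq
      obtain ⟨hzZ, hzy⟩ := Finset.mem_filter.1 hz
      intro j hj
      set q := z - z₀ with hqd
      obtain ⟨a, ha⟩ : ∃ a, a = ((Finset.univ : Finset (Fin m)).filter
        (fun i => |q j| ≤ |q i|)).card := ⟨_, rfl⟩
      rw [← ha]
      have ha1 : 1 ≤ a := by rw [ha]; exact Finset.card_pos.2 ⟨j, by simp⟩
      have hqj := one_le_abs_cast hj
      have hqj0 : 0 < |(q j : ℝ)| := by linarith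
      have hs : G z - f z - (G z₀ - f z) = spread n p hm fun l => κ * (q l : ℝ) := by
        funext j
        simp only [hG, hqd, Pi.sub_apply, spread]
        push_cast
        ring
      have h1 := lorentzSum_sub_le (n := n) hb hv (G z - f z) (G z₀ - f z)
      rw [hs] at h1
      have h2 := hfε z hzZ
      have h3 := hfε z₀ hz₀Z
      rw [hz₀y, ← hzy] at h3
      have h4 := hlow n m a hm (fun l => κ * (q l : ℝ)) (κ * |(q j : ℝ)|) hmn (by positivity) ha1
        (by
          rw [ha]
          congr 1
          ext i
          simp only [Finset.mem_filter, Finset.mem_univ, true_and]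
          rw [abs_mul, abs_of_pos hκ0, mul_le_mul_iff_right₀ hκ0]
          norm_cast)
      have h5 : c₂ * ((a : ℝ) / m) ^ (v / p) * (κ * |(q j : ℝ)|) ^ v * Λ ≤ K * (2 * ε ^ v) := by
        refine h4.trans (h1.trans ?_)
        rw [← hK]
        gcongr
        linarith
      have h6 : ε ^ v < (c₂ / (2 * K)) * (κ ^ v * Λ) := by
        have h7 : ε < (c₂ / (2 * K)) ^ v⁻¹ * (κ * Λ ^ (v⁻¹)) := by
          refine hlt.trans_eq ?_
          rw [hc₃, hκ, one_div, sub_eq_add_neg, Real.rpow_add hΛ0]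
          ring
        have h8 := Real.rpow_lt_rpow hε.le h7 hv
        rwa [Real.mul_rpow (by positivity) (by positivity), Real.mul_rpow hκ0.le (by positivity),
          Real.rpow_inv_rpow (by positivity) hv.ne', Real.rpow_inv_rpow hΛ0.le hv.ne'] at h8
      have h9 : ((a : ℝ) / m) ^ (v / p) * |(q j : ℝ)| ^ v < 1 := by
        rw [Real.mul_rpow hκ0.le hqj0.le] at h5
        have h10 : (c₂ * κ ^ v * Λ) * (((a : ℝ) / m) ^ (v / p) * |(q j : ℝ)| ^ v) <
            (c₂ * κ ^ v * Λ) * 1 := by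
          calc _ = c₂ * ((a : ℝ) / m) ^ (v / p) * (κ ^ v * |(q j : ℝ)| ^ v) * Λ := by ring
            _ ≤ K * (2 * ε ^ v) := h5
            _ < K * (2 * ((c₂ / (2 * K)) * (κ ^ v * Λ))) := by gcongr
            _ = _ := by field_simp
        exact lt_of_mul_lt_mul_left h10 (by positivity)
      have h10 : ((a : ℝ) / m) ^ (v / p) * |(q j : ℝ)| ^ v =
          ((a : ℝ) / m * |(q j : ℝ)| ^ p) ^ (v / p) := by
        rw [Real.mul_rpow (by positivity) (by positivity), ← Real.rpow_mul hqj0.le,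
          mul_div_cancel₀ _ hp.ne']
      rw [h10] at h9
      have h11 : (a : ℝ) / m * |(q j : ℝ)| ^ p ≤ 1 := by
        by_contra! hc
        exact absurd h9 (not_lt.2 (Real.one_le_rpow hc.le hb.le))
      rw [div_mul_eq_mul_div, div_le_one hm0] at h11
      exact h11
    · rw [Real.one_rpow, mul_one, mul_one, ← Real.exp_add, hC₀, ← Real.exp_nat_mul]
      congr 1
      ring
  have hcount : (M : ℝ) ^ m ≤ 2 ^ (k - 1) * C₀ ^ m := by
    have h1 := Finset.card_eq_sum_card_fiberwise (f := f) (s := Z) (t := T)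
      (fun z hz => hfT z hz)
    rw [hZc] at h1
    calc (M : ℝ) ^ m = ∑ y ∈ T, ((Z.filter fun z => f z = y).card : ℝ) := by exact_mod_cast h1
      _ ≤ ∑ y ∈ T, C₀ ^ m := Finset.sum_le_sum hfib
      _ = T.card * C₀ ^ m := by rw [Finset.sum_const, nsmul_eq_mul]
      _ ≤ _ := by
        gcongr
        exact_mod_cast hT
  have hle : C₀ ^ m * 2 ^ k ≤ C₀ ^ m * 2 ^ (k - 1) := by
    rw [← hEm, ← mul_pow, mul_comm (C₀ ^ m)]
    exact (pow_le_pow_left₀ (by positivity) hM1 m).trans hcount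
  have hlt' := le_of_mul_le_mul_left hle (by positivity)
  exact absurd hlt' (not_le.2 (pow_lt_pow_right₀ (by norm_num) (by omega)))

end LowerBound

lemma lorentzCovers_iff {n k : ℕ} {p v : ℝ≥0∞} (hv : 0 < v) (hv' : v ≠ ⊤)
    {NX : (n : ℕ) → (Fin n → ℝ) → ℝ} {ε : ℝ} (hε : 0 < ε) :
    LorentzCovers n (NX n) (v.toReal / p.toReal) v.toReal k ε ↔
      ∃ T : Finset (Fin n → ℝ), T.card ≤ 2 ^ (k - 1) ∧
        ∀ x : Fin n → ℝ, NX n x ≤ 1 → ∃ y ∈ T, lorentzNorm n p v (x - y) ≤ ε := by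
  simp only [LorentzCovers, lorentzNorm_le_iff hv hv' hε.le]

lemma entropyNumber_le_of_lorentzCovers {n k : ℕ} {p v : ℝ≥0∞} (hv : 0 < v) (hv' : v ≠ ⊤)
    {NX : (n : ℕ) → (Fin n → ℝ) → ℝ} {ε : ℝ} (hε : 0 < ε)
    (h : LorentzCovers n (NX n) (v.toReal / p.toReal) v.toReal k ε) :
    entropyNumber n (NX n) (lorentzNorm n p v) k ≤ ε :=
  csInf_le ⟨0, fun _ hx => hx.1.le⟩ ⟨hε, (lorentzCovers_iff hv hv' hε).1 h⟩

lemma le_entropyNumber_of_lorentzCovers {n k : ℕ} {p v : ℝ≥0∞} (hv : 0 < v) (hv' : v ≠ ⊤)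
    {NX : (n : ℕ) → (Fin n → ℝ) → ℝ} {ε₀ b : ℝ} (hε₀ : 0 < ε₀)
    (h : LorentzCovers n (NX n) (v.toReal / p.toReal) v.toReal k ε₀)
    (hb : ∀ ε : ℝ, 0 < ε → LorentzCovers n (NX n) (v.toReal / p.toReal) v.toReal k ε → b ≤ ε) :
    b ≤ entropyNumber n (NX n) (lorentzNorm n p v) k :=
  le_csInf ⟨ε₀, hε₀, (lorentzCovers_iff hv hv' hε₀).1 h⟩ fun ε hε =>
    hb ε hε.1 ((lorentzCovers_iff hv hv' hε.1).2 hε.2)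

lemma one_add_log_le {n k : ℕ} (hk : 1 ≤ k) (hkn : k ≤ n) :
    1 + Real.log ((n : ℝ) / k) ≤ 3 * Real.log ((n : ℝ) / k + 1) := by
  have hk0 : (0 : ℝ) < k := by exact_mod_cast hk
  have h1 : (1 : ℝ) ≤ n / k := (one_le_div hk0).2 (by exact_mod_cast hkn)
  have h2 : Real.log 2 ≤ Real.log ((n : ℝ) / k + 1) :=
    Real.log_le_log (by norm_num) (by linarith)
  have h3 : Real.log ((n : ℝ) / k) ≤ Real.log ((n : ℝ) / k + 1) :=
    Real.log_le_log (by linarith) (by linarith)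
  linarith [Real.log_two_gt_d9]

lemma log_add_one_le {n k : ℕ} (hk : 1 ≤ k) (hkn : k ≤ n) :
    Real.log ((n : ℝ) / k + 1) ≤ 1 + Real.log ((n : ℝ) / k) := by
  have hk0 : (0 : ℝ) < k := by exact_mod_cast hk
  have h1 : (1 : ℝ) ≤ n / k := (one_le_div hk0).2 (by exact_mod_cast hkn)
  have h2 : Real.log ((n : ℝ) / k + 1) ≤ Real.log 2 + Real.log ((n : ℝ) / k) := by
    rw [← Real.log_mul (by norm_num) (by linarith)]
    exact Real.log_le_log (by linarith) (by linarith)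
  linarith [Real.log_two_lt_d9]

lemma exists_lorentzCovers_of_ge {p v θ Cw c₁ : ℝ} {NX : (n : ℕ) → (Fin n → ℝ) → ℝ}
    (hNX : LorentzLike p v θ Cw c₁ NX) (hp : 0 < p) (hv : 0 < v) (hCw : 0 < Cw)
    (hvθ : v * θ < 1) :
    ∃ C : ℝ, 0 < C ∧ ∀ n k : ℕ, 1 ≤ n → n ≤ k →
      LorentzCovers n (NX n) (v / p) v k (C * 2 ^ (-(k : ℝ) / n)) := by
  obtain ⟨C₁, hC₁, h₁⟩ := exists_lorentzCovers_of_le hNX hp hv hCw hvθ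
  obtain ⟨C₂, hC₂, h₂⟩ := exists_lorentzCovers_of_pow_le hNX hp hv hCw
  set C₀ := Real.exp (4 + 2 / p) with hC₀
  have hC₀0 : 0 < C₀ := Real.exp_pos _
  refine ⟨6 * C₀ * C₁ + 12 * C₀ * C₂, by positivity, fun n k hn hnk => ?_⟩
  have hn0 : (0 : ℝ) < n := by exact_mod_cast hn
  obtain ⟨E, hE⟩ : ∃ E : ℝ, E = 2 ^ (((k - 1 : ℕ) : ℝ) / n) := ⟨_, rfl⟩
  have hE0 : 0 < E := by rw [hE]; positivity
  have hEn : E ^ n = 2 ^ (k - 1) := by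
    rw [hE, ← Real.rpow_mul_natCast (by norm_num), div_mul_cancel₀ _ hn0.ne', Real.rpow_natCast]
  have hEk : E⁻¹ ≤ 2 * (2 : ℝ) ^ (-(k : ℝ) / n) := by
    rw [hE, ← Real.rpow_neg (by norm_num)]
    nth_rewrite 2 [← Real.rpow_one 2]
    rw [← Real.rpow_add (by norm_num)]
    refine Real.rpow_le_rpow_of_exponent_le (by norm_num) ?_
    have hn1 : (1 : ℝ) ≤ n := by exact_mod_cast hn
    rw [← neg_div, add_div' _ _ _ hn0.ne', Nat.cast_sub (by omega)]
    gcongr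
    push_cast
    linarith
  have hinv : (2 : ℝ) ^ (-(k : ℝ) / n) * E ≤ 1 := by
    rw [hE, ← Real.rpow_add (by norm_num), ← add_div, Nat.cast_sub (by omega)]
    refine Real.rpow_le_one_of_one_le_of_nonpos (by norm_num) ?_
    exact div_nonpos_of_nonpos_of_nonneg (by push_cast; linarith) hn0.le
  obtain ⟨D, hD⟩ : ∃ D : ℝ, D = 2 ^ (-(k : ℝ) / n) := ⟨_, rfl⟩
  rw [← hD] at hEk hinv ⊢
  have hD0 : 0 < D := by rw [hD]; positivity
  have hCE : 0 < 3 * C₀ := by positivity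
  have hE2 : 1 ≤ 2 * D * E := by
    have := mul_le_mul_of_nonneg_right hEk hE0.le
    rwa [inv_mul_cancel₀ hE0.ne'] at this
  rcases lt_or_ge E (3 * C₀) with hlt | hge
  · have hcov := h₁ n n hn le_rfl
    rw [div_self hn0.ne', Real.log_one, add_zero, Real.one_rpow, mul_one] at hcov
    refine hcov.mono hv.le hC₁.le hnk ?_
    have h3 : 1 ≤ 6 * C₀ * D := by nlinarith
    nlinarith [mul_pos (mul_pos hC₀0 hC₂) hD0]
  · obtain ⟨M, hM⟩ : ∃ M, M = ⌊E / (3 * C₀)⌋₊ := ⟨_, rfl⟩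
    have hq : 1 ≤ E / (3 * C₀) := (one_le_div hCE).2 hge
    have hM1 : 1 ≤ M := by
      rw [hM]
      exact Nat.le_floor (by simpa using hq)
    have hM0 : (1 : ℝ) ≤ M := by exact_mod_cast hM1
    have hM2 : (M : ℝ) ≤ E / (3 * C₀) := by
      rw [hM]
      exact Nat.floor_le (by linarith)
    have hM3 : E / (3 * C₀) < M + 1 := by
      rw [hM]
      exact Nat.lt_floor_add_one _
    refine (h₂ n k M hn hM1 ?_).mono hv.le (by positivity) le_rfl ?_
    · rw [← hEn]
      refine pow_le_pow_left₀ (by positivity) ?_ n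
      rw [le_div_iff₀ hCE] at hM2
      linarith
    · rw [div_lt_iff₀ hCE] at hM3
      rw [div_le_iff₀ (by linarith)]
      have h4 : E ≤ 6 * C₀ * M := by nlinarith
      have h5 : 1 ≤ 12 * C₀ * D * M := by nlinarith
      have h6 : 0 ≤ 6 * C₀ * C₁ * D * M := by positivity
      nlinarith

/-- Case (III.2) of the main theorem: for `0 < p = q < ∞` and `0 < v < u ≤ ∞`, uniformly
in `k` and `n`, `e_k(id : ℓ_{p,u}^n → ℓ_{p,v}^n) ≍ (log(n/k + 1))^{1/v - 1/u}` for
`1 ≤ k ≤ n` and `≍ 2^{-k/n}` for `k ≥ n`. -/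
theorem entropy_lorentz_pu_pv_of_gt
    (p u v : ℝ≥0∞) (hp : 0 < p) (hp' : p ≠ ⊤) (hv : 0 < v) (hvu : v < u) :
    ∃ c C : ℝ, 0 < c ∧ 0 < C ∧ ∀ n : ℕ, 0 < n →
      (∀ k : ℕ, 1 ≤ k → k ≤ n →
        c * Real.log ((n : ℝ) / (k : ℝ) + 1) ^ ((1 / v).toReal - (1 / u).toReal) ≤
            entropyNumber n (lorentzNorm n p u) (lorentzNorm n p v) k ∧
          entropyNumber n (lorentzNorm n p u) (lorentzNorm n p v) k ≤
            C * Real.log ((n : ℝ) / (k : ℝ) + 1) ^ ((1 / v).toReal - (1 / u).toReal)) ∧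
      (∀ k : ℕ, n ≤ k →
        c * (2 : ℝ) ^ (-(k : ℝ) / (n : ℝ)) ≤
            entropyNumber n (lorentzNorm n p u) (lorentzNorm n p v) k ∧
          entropyNumber n (lorentzNorm n p u) (lorentzNorm n p v) k ≤
            C * (2 : ℝ) ^ (-(k : ℝ) / (n : ℝ))) := by
  have hv' : v ≠ ⊤ := hvu.ne_top
  have hP : 0 < p.toReal := ENNReal.toReal_pos hp.ne' hp'
  have hV : 0 < v.toReal := ENNReal.toReal_pos hv.ne' hv'
  obtain ⟨θ, Cw, c₁, hθ, hCw, hc₁, hvθ, hNX⟩ : ∃ θ Cw c₁ : ℝ, θ = (1 / u).toReal ∧ 0 < Cw ∧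
      0 < c₁ ∧ v.toReal * θ < 1 ∧
      LorentzLike p.toReal v.toReal θ Cw c₁ (fun n => lorentzNorm n p u) := by
    rcases eq_or_ne u ⊤ with rfl | hu
    · exact ⟨0, 1, 1, by simp, one_pos, one_pos, by simp, lorentzLike_top hp hp' hV⟩
    · have hlt : v.toReal < u.toReal := (ENNReal.toReal_lt_toReal hv' hu).2 hvu
      obtain ⟨Cw, c₁, hCw, hc₁, h⟩ := lorentzLike_of_ne_top hp hp' hu hV hlt
      refine ⟨u.toReal⁻¹, Cw, c₁, by simp, hCw, hc₁, ?_, h⟩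
      rw [← div_eq_mul_inv, div_lt_one (hV.trans hlt)]
      exact hlt
  rw [← hθ, show (1 / v).toReal = 1 / v.toReal by simp]
  have hs : 0 ≤ 1 / v.toReal - θ := by
    rw [sub_nonneg, le_div_iff₀ hV]
    linarith
  obtain ⟨C₁, hC₁, hup₁⟩ := exists_lorentzCovers_of_le hNX hP hV hCw hvθ
  obtain ⟨C₂, hC₂, hup₂⟩ := exists_lorentzCovers_of_ge hNX hP hV hCw hvθ
  obtain ⟨c, hc, hlow⟩ := exists_le_of_lorentzCovers hNX hP hV hc₁
  set s := 1 / v.toReal - θ with hsd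
  refine ⟨c / 2, C₁ * 3 ^ s + C₂, by positivity, by positivity, fun n hn =>
    ⟨fun k hk hkn => ?_, fun k hnk => ?_⟩⟩
  · have hk0 : (0 : ℝ) < k := by exact_mod_cast hk
    have hΛ := one_le_one_add_log hk hkn
    have hlog : 0 ≤ Real.log ((n : ℝ) / k + 1) := Real.log_nonneg (by simp; positivity)
    have hcov := hup₁ n k hk hkn
    have hε : 0 < C₁ * (1 + Real.log ((n : ℝ) / k)) ^ s := by positivity
    refine ⟨le_entropyNumber_of_lorentzCovers (NX := fun n => lorentzNorm n p u) hv hv' hε hcov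
      fun ε hε h => le_trans ?_ (hlow n k k ε hk hkn hk hε h),
      (entropyNumber_le_of_lorentzCovers (NX := fun n => lorentzNorm n p u) hv hv' hε hcov).trans
        ?_⟩
    · rw [neg_div, div_self hk0.ne', Real.rpow_neg_one, ← div_eq_mul_inv, div_mul_eq_mul_div]
      gcongr
      exact log_add_one_le hk hkn
    · have h := Real.rpow_le_rpow (by linarith) (one_add_log_le hk hkn) hs
      rw [Real.mul_rpow (by norm_num) hlog] at h
      have h' : 0 ≤ C₂ * Real.log ((n : ℝ) / k + 1) ^ s := by positivity
      calc _ ≤ C₁ * (3 ^ s * Real.log ((n : ℝ) / k + 1) ^ s) := by gcongr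
        _ ≤ _ := by linarith
  · have hn0 : (0 : ℝ) < n := by exact_mod_cast hn
    have hcov := hup₂ n k hn hnk
    have hD : (0 : ℝ) < 2 ^ (-(k : ℝ) / n) := by positivity
    have hε : 0 < C₂ * (2 : ℝ) ^ (-(k : ℝ) / n) := by positivity
    refine ⟨le_entropyNumber_of_lorentzCovers (NX := fun n => lorentzNorm n p u) hv hv' hε hcov
      fun ε hε h => le_trans ?_ (hlow n n k ε hn le_rfl (hn.trans_le hnk) hε h),
      (entropyNumber_le_of_lorentzCovers (NX := fun n => lorentzNorm n p u) hv hv' hε hcov).trans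
        ?_⟩
    · rw [div_self hn0.ne', Real.log_one, add_zero, Real.one_rpow, mul_one]
      gcongr
      linarith
    · gcongr
      exact le_add_of_nonneg_left (by positivity)
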